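/- arXiv:1212.2091 — 14 statements merged into one kernel-verified Lean document; each statement's English description precedes it below -/
import Mathlib

section
/- Let t be an integer with 1 ≤ t ≤ q₀−1 and let (a,b,c,d) be a 4-tuple of non-negative integers. Then ‖(a,b,c,d)‖ ≤ t(q+2q₀+1) if and only if a+b+c+d ≤ t. -/
/-- For `1 ≤ t ≤ q₀ - 1`, `‖(a,b,c,d)‖ ≤ t(q+2q₀+1)` iff `a+b+c+d ≤ t`. -/
theorem suzuki_norm_le_iff (n : ℕ) (hn : 2 ≤ n) (q₀ q : ℕ) (hq₀ : q₀ = 2 ^ n)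
    (hq : q = 2 * q₀ ^ 2) (t : ℕ) (ht1 : 1 ≤ t) (ht2 : t ≤ q₀ - 1)
    (a b c d : ℕ) :
    a * q + b * (q + q₀) + c * (q + 2 * q₀) + d * (q + 2 * q₀ + 1) ≤
      t * (q + 2 * q₀ + 1) ↔ a + b + c + d ≤ t := by
  have gap : t * (2 * q₀ + 1) < q := by
    have ht : t + 1 ≤ q₀ := by omega
    nlinarith
  constructor
  · intro h
    by_contra! hlt
    have hq_le : (t + 1) * q ≤ (a + b + c + d) * q := Nat.mul_le_mul_right q hlt
    have hb := Nat.zero_le (b * q₀)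
    have hc := Nat.zero_le (c * q₀)
    have hd := Nat.zero_le (d * q₀)
    linarith
  · intro h
    calc a * q + b * (q + q₀) + c * (q + 2 * q₀) + d * (q + 2 * q₀ + 1)
        ≤ a * (q + 2 * q₀ + 1) + b * (q + 2 * q₀ + 1) + c * (q + 2 * q₀ + 1)
          + d * (q + 2 * q₀ + 1) := by
          refine add_le_add (add_le_add (add_le_add ?_ ?_) ?_) le_rfl <;>
            exact Nat.mul_le_mul_left _ (by omega)
      _ = (a + b + c + d) * (q + 2 * q₀ + 1) := by ring
      _ ≤ t * (q + 2 * q₀ + 1) := Nat.mul_le_mul_right _ h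
end

section
/- Let t be an integer with 1 ≤ t ≤ q₀−1 and let (a',b',c',d') be a 4-tuple of non-negative integers with ‖(a',b',c',d')‖ ≤ t(q+2q₀+1). Then there exists a unique 4-tuple (a,b,c,d) of non-negative integers with b ∈ {0,1} and ‖(a,b,c,d)‖ = ‖(a',b',c',d')‖. -/
/-- The weighted value `‖(a,b,c,d)‖ = aq + b(q+q₀) + c(q+2q₀) + d(q+2q₀+1)`. -/
def suzukiNorm (q₀ q : ℕ) (x : ℕ × ℕ × ℕ × ℕ) : ℕ :=
  x.1 * q + x.2.1 * (q + q₀) + x.2.2.1 * (q + 2 * q₀) + x.2.2.2 * (q + 2 * q₀ + 1)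

/-- Quotient and remainder with respect to `k` are unique. -/
theorem eq_and_eq_of_mul_add_eq {k s r s' r' : ℕ} (hr : r < k) (hr' : r' < k)
    (h : s * k + r = s' * k + r') : s = s' ∧ r = r' := by
  have hk : 0 < k := by omega
  have hdiv := congrArg (· / k) h
  have hmod := congrArg (· % k) h
  simp only [Nat.mul_add_mod_self_right, Nat.mod_eq_of_lt hr, Nat.mod_eq_of_lt hr'] at hmod
  refine ⟨?_, hmod⟩
  subst hmod
  exact Nat.eq_of_mul_eq_mul_right hk (by omega)

/-- Grouping of `suzukiNorm` by powers of `q₀`. -/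
theorem suzukiNorm_eq (q₀ q a b c d : ℕ) :
    suzukiNorm q₀ q (a, b, c, d) =
      (a + b + c + d) * q + ((b + 2 * c + 2 * d) * q₀ + d) := by
  simp only [suzukiNorm]
  ring

/-- A tuple of small norm has coordinate sum less than `q₀`. -/
theorem sum_lt_of_suzukiNorm_le {q₀ t a b c d : ℕ} (ht : t < q₀)
    (h : suzukiNorm q₀ (2 * q₀ ^ 2) (a, b, c, d) ≤ t * (2 * q₀ ^ 2 + 2 * q₀ + 1)) :
    a + b + c + d < q₀ := by
  by_contra! hs
  obtain ⟨m, rfl⟩ : ∃ m, q₀ = m + 1 := ⟨q₀ - 1, by omega⟩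
  rw [suzukiNorm_eq] at h
  have hlow := Nat.mul_le_mul_right (2 * (m + 1) ^ 2) hs
  have hup := Nat.mul_le_mul_right (2 * (m + 1) ^ 2 + 2 * (m + 1) + 1) (Nat.le_of_lt_succ ht)
  nlinarith

/-- If the coordinate sum is less than `q₀`, the part of the norm below `q` is a remainder. -/
theorem remainder_lt_of_sum_lt {q₀ a b c d : ℕ} (hs : a + b + c + d < q₀) :
    (b + 2 * c + 2 * d) * q₀ + d < 2 * q₀ ^ 2 := by
  obtain ⟨m, rfl⟩ : ∃ m, q₀ = m + 1 := ⟨q₀ - 1, by omega⟩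
  have hle : b + 2 * c + 2 * d ≤ 2 * m := by omega
  have hmul := Nat.mul_le_mul_right (m + 1) hle
  nlinarith

/-- Tuples with second coordinate at most `1` and coordinate sum less than `q₀` are determined
by their norm. -/
theorem eq_of_suzukiNorm_eq {q₀ a b c d a' b' c' d' : ℕ} (hb : b ≤ 1) (hb' : b' ≤ 1)
    (hs : a + b + c + d < q₀) (hs' : a' + b' + c' + d' < q₀)
    (h : suzukiNorm q₀ (2 * q₀ ^ 2) (a, b, c, d) =
      suzukiNorm q₀ (2 * q₀ ^ 2) (a', b', c', d')) :
    a = a' ∧ b = b' ∧ c = c' ∧ d = d' := by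
  rw [suzukiNorm_eq, suzukiNorm_eq] at h
  obtain ⟨hsum, hrem⟩ :=
    eq_and_eq_of_mul_add_eq (remainder_lt_of_sum_lt hs) (remainder_lt_of_sum_lt hs') h
  obtain ⟨hmid, hd⟩ := eq_and_eq_of_mul_add_eq (by omega) (by omega) hrem
  omega

/-- Replacing two copies of `q + q₀` by one of `q` and one of `q + 2q₀` preserves the norm. -/
theorem suzukiNorm_reduce (q₀ q a b c d : ℕ) :
    suzukiNorm q₀ q (a + b / 2, b % 2, c + b / 2, d) = suzukiNorm q₀ q (a, b, c, d) := by
  have hb := Nat.div_add_mod b 2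
  generalize b / 2 = k at *
  generalize b % 2 = r at *
  subst hb
  simp only [suzukiNorm]
  ring

/-- uniqueness of the representative with `b ∈ {0,1}` for values
`≤ t(q+2q₀+1)` with `1 ≤ t ≤ q₀ - 1`. -/
theorem suzuki_unique_rep_b (n : ℕ) (hn : 2 ≤ n) (q₀ q : ℕ) (hq₀ : q₀ = 2 ^ n)
    (hq : q = 2 * q₀ ^ 2) (t : ℕ) (ht1 : 1 ≤ t) (ht2 : t ≤ q₀ - 1)
    (a' b' c' d' : ℕ)
    (h : suzukiNorm q₀ q (a', b', c', d') ≤ t * (q + 2 * q₀ + 1)) :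
    ∃! x : ℕ × ℕ × ℕ × ℕ, x.2.1 ≤ 1 ∧
      suzukiNorm q₀ q x = suzukiNorm q₀ q (a', b', c', d') := by
  have ht : t < q₀ := by omega
  subst hq
  refine ⟨(a' + b' / 2, b' % 2, c' + b' / 2, d'),
    ⟨Nat.le_of_lt_succ (Nat.mod_lt _ two_pos), suzukiNorm_reduce ..⟩, ?_⟩
  rintro ⟨a, b, c, d⟩ ⟨hb, hx⟩
  have hred := suzukiNorm_reduce q₀ (2 * q₀ ^ 2) a' b' c' d'
  obtain ⟨rfl, rfl, rfl, rfl⟩ := eq_of_suzukiNorm_eq hb (Nat.le_of_lt_succ (Nat.mod_lt _ two_pos))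
    (sum_lt_of_suzukiNorm_le ht (hx.trans_le h)) (sum_lt_of_suzukiNorm_le ht (hred.trans_le h))
    (hx.trans hred.symm)
  rfl
end

section
/- Let (a',b',c',d') be any 4-tuple of non-negative integers. Then there exists a unique 4-tuple (a,b,c,d) of non-negative integers satisfying 0 ≤ b ≤ 1, 0 ≤ c ≤ q₀−1, 0 ≤ d ≤ q₀−1 and ‖(a,b,c,d)‖ = ‖(a',b',c',d')‖. -/
theorem eq_and_eq_of_add_mul_eq {m r r' s s' : ℕ} (hr : r < m) (hr' : r' < m)
    (h : r + m * s = r' + m * s') : r = r' ∧ s = s' := by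
  have hmod := congrArg (· % m) h
  simp only [Nat.add_mul_mod_self_left, Nat.mod_eq_of_lt hr, Nat.mod_eq_of_lt hr'] at hmod
  subst hmod
  exact ⟨rfl, Nat.eq_of_mul_eq_mul_left (by omega) (Nat.add_left_cancel h)⟩

theorem suzukiNorm_eq_nested (m a b c d : ℕ) :
    suzukiNorm m (2 * m ^ 2) (a, b, c, d) =
      d + m * (b + 2 * (c + d + m * (a + b + c + d))) := by
  simp only [suzukiNorm]
  ring

theorem suzukiNorm_injective_of_reduced {m a b c d a' b' c' d' : ℕ}
    (hb : b < 2) (hc : c < m) (hd : d < m) (hb' : b' < 2) (hc' : c' < m) (hd' : d' < m)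
    (h : suzukiNorm m (2 * m ^ 2) (a, b, c, d) = suzukiNorm m (2 * m ^ 2) (a', b', c', d')) :
    (a, b, c, d) = (a', b', c', d') := by
  rw [suzukiNorm_eq_nested, suzukiNorm_eq_nested] at h
  obtain ⟨rfl, h⟩ := eq_and_eq_of_add_mul_eq hd hd' h
  obtain ⟨rfl, h⟩ := eq_and_eq_of_add_mul_eq hb hb' h
  obtain ⟨rfl, h⟩ := eq_and_eq_of_add_mul_eq (s := a + b + c + d) (s' := a' + b + c' + d)
    hc hc' (by linarith)
  obtain rfl : a = a' := by omega
  rfl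

/-- Reduction uses `m(q+2m+1) = mq + (q+m)`, `2(q+m) = q + (q+2m)` and `m(q+2m) = (m+1)q`
for `q = 2m²`. -/
theorem exists_reduced_suzukiNorm_eq {m : ℕ} (hm : 0 < m) (a' b' c' d' : ℕ) :
    ∃ a b c d : ℕ, b < 2 ∧ c < m ∧ d < m ∧
      suzukiNorm m (2 * m ^ 2) (a, b, c, d) = suzukiNorm m (2 * m ^ 2) (a', b', c', d') := by
  obtain ⟨D, d, hd, rfl⟩ : ∃ D d, d < m ∧ d' = d + m * D :=
    ⟨d' / m, d' % m, Nat.mod_lt _ hm, (Nat.mod_add_div _ _).symm⟩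
  obtain ⟨B, b, hb, hB⟩ : ∃ B b, b < 2 ∧ b' + D = b + 2 * B :=
    ⟨(b' + D) / 2, (b' + D) % 2, Nat.mod_lt _ two_pos, (Nat.mod_add_div _ _).symm⟩
  obtain ⟨C, c, hc, hC⟩ : ∃ C c, c < m ∧ c' + B = c + m * C :=
    ⟨(c' + B) / m, (c' + B) % m, Nat.mod_lt _ hm, (Nat.mod_add_div _ _).symm⟩
  refine ⟨a' + m * D + B + (m + 1) * C, b, c, d, hb, hc, hd, ?_⟩
  simp only [suzukiNorm]
  zify at hB hC ⊢
  linear_combination (-(2 * m ^ 2 + m) : ℤ) * hB - (2 * m ^ 2 + 2 * m : ℤ) * hC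

/-- every value `‖(a',b',c',d')‖` has a unique representative with
`b ≤ 1`, `c ≤ q₀ - 1` and `d ≤ q₀ - 1`. -/
theorem suzuki_unique_rep (n : ℕ) (hn : 2 ≤ n) (q₀ q : ℕ) (hq₀ : q₀ = 2 ^ n)
    (hq : q = 2 * q₀ ^ 2) (a' b' c' d' : ℕ) :
    ∃! x : ℕ × ℕ × ℕ × ℕ, x.2.1 ≤ 1 ∧ x.2.2.1 ≤ q₀ - 1 ∧ x.2.2.2 ≤ q₀ - 1 ∧
      suzukiNorm q₀ q x = suzukiNorm q₀ q (a', b', c', d') := by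
  subst hq
  have hm : 0 < q₀ := hq₀ ▸ Nat.two_pow_pos n
  obtain ⟨a, b, c, d, hb, hc, hd, h⟩ := exists_reduced_suzukiNorm_eq hm a' b' c' d'
  refine ⟨(a, b, c, d), ⟨by dsimp only; omega, by dsimp only; omega, by dsimp only; omega, h⟩, ?_⟩
  rintro ⟨a₁, b₁, c₁, d₁⟩ ⟨hb₁, hc₁, hd₁, h₁⟩
  dsimp only at hb₁ hc₁ hd₁
  exact suzukiNorm_injective_of_reduced (by omega) (by omega) (by omega) hb hc hd (h₁.trans h.symm)
end

section
/- Let t be an integer with 2 ≤ t ≤ q₀−1. Then the number of elements s ∈ H with s ≤ t(q+2q₀+1) equals C(t+4,4) − C(t+2,4), where C(m,k) denotes the binomial coefficient. -/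
theorem mem_closure_suzuki_iff (q₀ q s : ℕ) :
    s ∈ AddSubmonoid.closure {q, q + q₀, q + 2 * q₀, q + 2 * q₀ + 1} ↔
      ∃ j m d : ℕ, 2 * d ≤ m ∧ m ≤ 2 * j ∧ s = j * q + m * q₀ + d := by
  constructor
  · intro hs
    induction hs using AddSubmonoid.closure_induction with
    | mem x hx =>
      rcases hx with rfl | rfl | rfl | rfl
      · exact ⟨1, 0, 0, by omega, by omega, by ring⟩
      · exact ⟨1, 1, 0, by omega, by omega, by ring⟩
      · exact ⟨1, 2, 0, by omega, by omega, by ring⟩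
      · exact ⟨1, 2, 1, by omega, by omega, by ring⟩
    | zero => exact ⟨0, 0, 0, by omega, by omega, by ring⟩
    | add x y _ _ hx hy =>
      obtain ⟨j, m, d, h1, h2, rfl⟩ := hx
      obtain ⟨j', m', d', h1', h2', rfl⟩ := hy
      exact ⟨j + j', m + m', d + d', by omega, by omega, by ring⟩
  · rintro ⟨j, m, d, h1, h2, rfl⟩
    obtain ⟨a, b, c, rfl, rfl⟩ : ∃ a b c, j = a + b + c + d ∧ m = b + 2 * c + 2 * d :=
      ⟨j - d - (m - 2 * d) % 2 - (m - 2 * d) / 2, (m - 2 * d) % 2, (m - 2 * d) / 2,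
        by omega, by omega⟩
    have h : (a + b + c + d) * q + (b + 2 * c + 2 * d) * q₀ + d =
        a • q + b • (q + q₀) + c • (q + 2 * q₀) + d • (q + 2 * q₀ + 1) := by
      simp only [smul_eq_mul]; ring
    rw [h]
    refine add_mem (add_mem (add_mem ?_ ?_) ?_) ?_ <;>
      exact nsmul_mem (AddSubmonoid.subset_closure (by simp)) _

theorem sum_range_sum_range_two_mul_add_one (t : ℕ) :
    ∑ j ∈ Finset.range (t + 1), ∑ e ∈ Finset.range (j + 1), (2 * e + 1) =
      (t + 4).choose 4 - (t + 2).choose 4 := by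
  have inner (j : ℕ) : ∑ e ∈ Finset.range (j + 1), (2 * e + 1) = (j + 1) ^ 2 := by
    induction j with
    | zero => simp
    | succ j ih => rw [Finset.sum_range_succ, ih]; ring
  have key : ∑ j ∈ Finset.range (t + 1), (j + 1) ^ 2 + (t + 2).choose 4 =
      (t + 4).choose 4 := by
    induction t with
    | zero => rfl
    | succ t ih =>
      have e1 : (t + 1 + 4).choose 4 = (t + 4).choose 3 + (t + 4).choose 4 :=
        Nat.choose_succ_succ' _ _
      have e2 : (t + 1 + 2).choose 4 = (t + 2).choose 3 + (t + 2).choose 4 :=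
        Nat.choose_succ_succ' _ _
      have e3 : (t + 4).choose 3 = (t + 3).choose 2 + (t + 3).choose 3 :=
        Nat.choose_succ_succ' _ _
      have e4 : (t + 3).choose 3 = (t + 2).choose 2 + (t + 2).choose 3 :=
        Nat.choose_succ_succ' _ _
      have e5 : (t + 3).choose 2 = (t + 2).choose 1 + (t + 2).choose 2 :=
        Nat.choose_succ_succ' _ _
      have e6 : (t + 2).choose 2 * 2 = (t + 2) * (t + 1) := by
        rw [Nat.choose_two_right]
        exact Nat.div_mul_cancel (Nat.even_mul_pred_self _).two_dvd
      rw [Finset.sum_range_succ]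
      simp only [Nat.choose_one_right] at e5
      nlinarith
  simp only [inner]
  omega

/-- for `2 ≤ t ≤ q₀ - 1` the number of `s ∈ H` with
`s ≤ t(q+2q₀+1)` is `C(t+4,4) - C(t+2,4)`. -/
theorem suzuki_count_mid (n : ℕ) (hn : 2 ≤ n) (q₀ q : ℕ) (hq₀ : q₀ = 2 ^ n)
    (hq : q = 2 * q₀ ^ 2) (H : AddSubmonoid ℕ)
    (hH : H = AddSubmonoid.closure {q, q + q₀, q + 2 * q₀, q + 2 * q₀ + 1})
    (t : ℕ) (ht1 : 2 ≤ t) (ht2 : t ≤ q₀ - 1) :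
    Set.ncard {s : ℕ | s ∈ H ∧ s ≤ t * (q + 2 * q₀ + 1)} =
      (t + 4).choose 4 - (t + 2).choose 4 := by
  have ht : t + 1 ≤ q₀ := by omega
  let T : Finset (Σ _ : ℕ, Σ _ : ℕ, ℕ) := (Finset.range (t + 1)).sigma fun j =>
    (Finset.range (j + 1)).sigma fun e => Finset.range (2 * e + 1)
  let f : (Σ _ : ℕ, Σ _ : ℕ, ℕ) → ℕ := fun x =>
    x.1 * q + (2 * (x.1 - x.2.1) + x.2.2) * q₀ + (x.1 - x.2.1)
  have hlt (m d : ℕ) (hd : d ≤ t) (hm : m ≤ 2 * t) : m * q₀ + d < q := by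
    rw [hq]; nlinarith
  have hinj : Set.InjOn f T := by
    rintro ⟨j, e, r⟩ hx ⟨j', e', r'⟩ hy hxy
    simp only [T, Finset.coe_sigma, Set.mem_sigma_iff, Finset.mem_coe,
      Finset.mem_range] at hx hy
    simp only [f, add_assoc] at hxy
    have b := hlt (2 * (j - e) + r) (j - e) (by omega) (by omega)
    have b' := hlt (2 * (j' - e') + r') (j' - e') (by omega) (by omega)
    have decomp (k p x k' x' : ℕ) (hx : x < p) (hx' : x' < p)
        (h : k * p + x = k' * p + x') : k = k' ∧ x = x' := by
      have hp : 0 < p := by omega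
      have h1 := congrArg (· / p) h
      have h2 := congrArg (· % p) h
      simp only [mul_comm _ p, Nat.mul_add_div hp, Nat.mul_add_mod, Nat.div_eq_of_lt hx,
        Nat.div_eq_of_lt hx', Nat.mod_eq_of_lt hx, Nat.mod_eq_of_lt hx', add_zero] at h1 h2
      exact ⟨h1, h2⟩
    obtain ⟨rfl, h2⟩ := decomp _ _ _ _ _ b b' hxy
    obtain ⟨h3, h4⟩ := decomp _ _ _ _ _ (by omega) (by omega) h2
    obtain rfl : e = e' := by omega
    obtain rfl : r = r' := by omega
    rfl
  have hset : {s : ℕ | s ∈ H ∧ s ≤ t * (q + 2 * q₀ + 1)} = (T.image f : Finset ℕ) := by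
    ext s
    simp only [hH, mem_closure_suzuki_iff, Set.mem_ofPred_eq, Finset.coe_image, Set.mem_image,
      Finset.mem_coe, T, Finset.mem_sigma, Finset.mem_range, f]
    constructor
    · rintro ⟨⟨j, m, d, h1, h2, rfl⟩, hs⟩
      have hj : j ≤ t := by
        by_contra! hj
        have := hlt (2 * t) t le_rfl le_rfl
        nlinarith [Nat.mul_le_mul_right q (Nat.succ_le_of_lt hj)]
      refine ⟨⟨j, j - d, m - 2 * d⟩, ⟨by simpa [Nat.lt_succ_iff] using hj, ?_, ?_⟩, ?_⟩
      · simp only; omega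
      · simp only; omega
      · have e1 : j - (j - d) = d := by omega
        have e2 : 2 * d + (m - 2 * d) = m := by omega
        simp only [e1, e2]
    · rintro ⟨⟨j, e, r⟩, ⟨hj, he, hr⟩, rfl⟩
      simp only at hj he hr ⊢
      refine ⟨⟨j, _, _, by omega, by omega, rfl⟩, ?_⟩
      have a1 : j * q ≤ t * q := Nat.mul_le_mul_right _ (by omega)
      have a2 : (2 * (j - e) + r) * q₀ ≤ (2 * t) * q₀ := Nat.mul_le_mul_right _ (by omega)
      have a3 : j - e ≤ t := by omega
      nlinarith
  rw [hset, Set.ncard_coe_finset, Finset.card_image_of_injOn hinj,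
    ← sum_range_sum_range_two_mul_add_one]
  simp [T, Finset.card_sigma]
end

section
/- Let t be an integer with q₀ ≤ t ≤ 2q₀−4. Then the number of elements s ∈ H with s ≤ t(q+2q₀+1) equals t(q+2q₀+1) + 1 − g + C(2q₀−t+2,4) − C(2q₀−t,4), where g := q₀(q−1) and C(m,k) denotes the binomial coefficient. -/
/-- The semigroup generated by `2a²`, `2a²+a`, `2a²+2a`, `2a²+2a+1`, described explicitly. -/
def SuzukiRep (a s : ℕ) : Prop :=
  ∃ d m l : ℕ, 2 * l ≤ m ∧ m ≤ 2 * d ∧ s = d * (2 * a ^ 2) + a * m + l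

theorem SuzukiRep.add {a s s' : ℕ} (h : SuzukiRep a s) (h' : SuzukiRep a s') :
    SuzukiRep a (s + s') := by
  obtain ⟨d, m, l, h1, h2, rfl⟩ := h
  obtain ⟨d', m', l', h1', h2', rfl⟩ := h'
  exact ⟨d + d', m + m', l + l', by omega, by omega, by ring⟩

theorem mem_closure_iff_suzukiRep (a s : ℕ) :
    s ∈ AddSubmonoid.closure
      ({2 * a ^ 2, 2 * a ^ 2 + a, 2 * a ^ 2 + 2 * a, 2 * a ^ 2 + 2 * a + 1} : Set ℕ) ↔
      SuzukiRep a s := by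
  constructor
  · intro h
    induction h using AddSubmonoid.closure_induction with
    | mem x hx =>
      simp only [Set.mem_insert_iff, Set.mem_singleton_iff] at hx
      rcases hx with rfl | rfl | rfl | rfl
      · exact ⟨1, 0, 0, by omega, by omega, by ring⟩
      · exact ⟨1, 1, 0, by omega, by omega, by ring⟩
      · exact ⟨1, 2, 0, by omega, by omega, by ring⟩
      · exact ⟨1, 2, 1, by omega, by omega, by ring⟩
    | zero => exact ⟨0, 0, 0, by omega, by omega, by ring⟩
    | add x y _ _ hx hy => exact hx.add hy
  · rintro ⟨d, m, l, h1, h2, rfl⟩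
    obtain ⟨j, k, i, rfl, rfl⟩ :
        ∃ j k i, m = j + 2 * k + 2 * l ∧ d = i + j + k + l :=
      ⟨m % 2, m / 2 - l, d - l - (m / 2 - l) - m % 2, by omega, by omega⟩
    have e : (i + j + k + l) * (2 * a ^ 2) + a * (j + 2 * k + 2 * l) + l =
        i • (2 * a ^ 2) + j • (2 * a ^ 2 + a) + k • (2 * a ^ 2 + 2 * a) +
          l • (2 * a ^ 2 + 2 * a + 1) := by
      simp only [smul_eq_mul]; ring
    rw [e]
    refine add_mem (add_mem (add_mem ?_ ?_) ?_) ?_ <;>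
      exact nsmul_mem (AddSubmonoid.subset_closure (by simp)) _

theorem not_suzukiRep_frobenius {a F : ℕ} (ha : 1 ≤ a) (hF : F + 2 * a + 1 = 4 * a ^ 3) :
    ¬ SuzukiRep a F := by
  rintro ⟨d, m, l, h1, h2, h⟩
  have hdvd : a ∣ l + 1 := by
    have e : a * (4 * a ^ 2) = a * (d * (2 * a) + m + 2) + (l + 1) := by
      subst h; linarith [hF, pow_succ a 2]
    exact (Nat.dvd_add_right (Dvd.intro _ rfl)).1 (e ▸ Dvd.intro _ rfl)
  obtain ⟨c, hc⟩ := hdvd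
  have e : 4 * a ^ 2 = 2 * a * d + m + 2 + c := by
    apply Nat.eq_of_mul_eq_mul_left (show 0 < a by omega)
    subst h; nlinarith [hF, hc]
  have hc1 : c = 1 := by
    rcases Nat.lt_or_ge c 2 with h' | h'
    · interval_cases c <;> omega
    · exfalso
      have : 2 * a ≤ c * a := Nat.mul_le_mul_right a h'
      nlinarith
  subst hc1
  have hdvd : 2 * a ∣ m + 3 := by
    have e' : 2 * a * (2 * a) = 2 * a * d + (m + 3) := by nlinarith
    exact (Nat.dvd_add_right (Dvd.intro _ rfl)).1 (e' ▸ Dvd.intro _ rfl)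
  obtain ⟨k, hk⟩ := hdvd
  have e2 : 2 * a = d + k := by
    apply Nat.eq_of_mul_eq_mul_left (show 0 < 2 * a by omega)
    nlinarith
  rcases Nat.lt_or_ge k 2 with h' | h'
  · interval_cases k <;> omega
  · nlinarith

theorem exists_suzuki_normal_form (a : ℕ) (ha : 1 ≤ a) (s : ℤ) :
    ∃ i j k l : ℤ, 0 ≤ j ∧ j ≤ 1 ∧ 0 ≤ k ∧ k ≤ a - 1 ∧ 0 ≤ l ∧ l ≤ a - 1 ∧
      s = i * (2 * a ^ 2) + j * (2 * a ^ 2 + a) + k * (2 * a ^ 2 + 2 * a) +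
        l * (2 * a ^ 2 + 2 * a + 1) := by
  have ha' : (0 : ℤ) < a := by exact_mod_cast ha
  obtain ⟨l, p, hl0, hl1, hs⟩ : ∃ l p : ℤ, 0 ≤ l ∧ l < a ∧ s = l + a * p :=
    ⟨s % a, s / a, Int.emod_nonneg _ ha'.ne', Int.emod_lt_of_pos _ ha',
      (Int.emod_add_mul_ediv s a).symm⟩
  obtain ⟨j, v, hj0, hj1, hv⟩ :
      ∃ j v : ℤ, 0 ≤ j ∧ j ≤ 1 ∧ p - l * (2 * a + 2) = j + 2 * v :=
    ⟨(p - l * (2 * a + 2)) % 2, (p - l * (2 * a + 2)) / 2, by omega, by omega, by omega⟩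
  obtain ⟨k, w, hk0, hk1, hw⟩ : ∃ k w : ℤ, 0 ≤ k ∧ k < a ∧ v = k + a * w :=
    ⟨v % a, v / a, Int.emod_nonneg _ ha'.ne', Int.emod_lt_of_pos _ ha',
      (Int.emod_add_mul_ediv v a).symm⟩
  refine ⟨w - k - j, j, k, l, hj0, hj1, hk0, by omega, hl0, by omega, ?_⟩
  have hp : p = l * (2 * a + 2) + j + 2 * (k + a * w) := by rw [← hw]; linarith
  rw [hs, hp]; ring

theorem suzukiRep_of_normal_form {a s : ℕ} {i j k l : ℤ} (hi : 0 ≤ i) (hj : 0 ≤ j) (hk : 0 ≤ k)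
    (hl : 0 ≤ l) (h : (s : ℤ) = i * (2 * a ^ 2) + j * (2 * a ^ 2 + a) + k * (2 * a ^ 2 + 2 * a) +
        l * (2 * a ^ 2 + 2 * a + 1)) : SuzukiRep a s := by
  lift i to ℕ using hi
  lift j to ℕ using hj
  lift k to ℕ using hk
  lift l to ℕ using hl
  refine ⟨i + j + k + l, j + 2 * k + 2 * l, l, by omega, by omega, ?_⟩
  zify; rw [h]; ring

/-- The semigroup is symmetric. -/
theorem suzukiRep_iff_not {a s s' : ℕ} (ha : 1 ≤ a) (hF : s + s' + 2 * a + 1 = 4 * a ^ 3) :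
    SuzukiRep a s ↔ ¬ SuzukiRep a s' := by
  refine ⟨fun h h' => not_suzukiRep_frobenius ha hF (h.add h'), fun h' => ?_⟩
  obtain ⟨i, j, k, l, hj0, hj1, hk0, hk1, hl0, hl1, hs⟩ := exists_suzuki_normal_form a ha s
  rcases le_or_gt 0 i with hi | hi
  · exact suzukiRep_of_normal_form hi hj0 hk0 hl0 hs
  · refine absurd (suzukiRep_of_normal_form (i := -1 - i) (j := 1 - j) (k := a - 1 - k)
      (l := a - 1 - l) ?_ ?_ ?_ ?_ ?_) h' <;> try omega
    have hF' : (s' : ℤ) = 4 * a ^ 3 - 2 * a - 1 - s := by zify at hF; linarith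
    rw [hF', hs]; ring

theorem Nat.count_reflect (P : ℕ → Prop) [DecidablePred P] (M : ℕ)
    (hP : ∀ s s', s + s' + 1 = M → (P s ↔ ¬ P s')) (K : ℕ) (hK : K ≤ M) :
    Nat.count P (M - K) + K = Nat.count P M + Nat.count P K := by
  induction K with
  | zero => simp
  | succ K ih =>
    have ih := ih (by omega)
    have h := hP (M - (K + 1)) K (by omega)
    rw [show M - K = M - (K + 1) + 1 by omega, Nat.count_succ] at ih
    rw [Nat.count_succ]
    by_cases hk : P K <;> simp only [hk, h, not_true, not_false_eq_true, if_true, if_false] at ih ⊢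
      <;> omega

theorem sum_range_succ_sq_add_choose (u : ℕ) :
    ∑ d ∈ Finset.range (u + 1), (d + 1) ^ 2 + (u + 2).choose 4 = (u + 4).choose 4 := by
  induction u with
  | zero => decide
  | succ u ih =>
    rw [Finset.sum_range_succ, Nat.choose_succ_succ' (u + 1 + 3) 3,
      show u + 1 + 3 = u + 4 by ring, ← ih, show u + 1 + 2 = u + 2 + 1 by ring,
      Nat.choose_succ_succ' (u + 2) 3, Nat.choose_succ_succ' (u + 3) 2,
      Nat.choose_succ_succ' (u + 2) 2, Nat.choose_succ_succ' (u + 2) 1, Nat.choose_one_right]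
    have h2 : (u + 2).choose 2 * 2 = (u + 2) * (u + 1) := by
      rw [Nat.choose_two_right]
      exact Nat.div_mul_cancel (by simpa using (Nat.even_mul_pred_self (u + 2)).two_dvd)
    nlinarith

theorem sum_range_odd (d : ℕ) :
    ∑ l ∈ Finset.range (d + 1), (2 * d + 1 - 2 * l) = (d + 1) ^ 2 := by
  rw [← Finset.sum_range_reflect]
  have : ∀ j ∈ Finset.range (d + 1), 2 * d + 1 - 2 * (d + 1 - 1 - j) = 2 * j + 1 := by
    intro j hj
    have := Finset.mem_range.1 hj
    omega
  rw [Finset.sum_congr rfl this]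
  clear this
  generalize d + 1 = e
  induction e with
  | zero => rfl
  | succ e ih => rw [Finset.sum_range_succ, ih]; ring

theorem suzuki_digits_unique {a d m l d' m' l' : ℕ} (hl : l < a) (hl' : l' < a)
    (hm : m < 2 * a) (hm' : m' < 2 * a)
    (h : d * (2 * a ^ 2) + a * m + l = d' * (2 * a ^ 2) + a * m' + l') :
    d = d' ∧ m = m' ∧ l = l' := by
  have key : ∀ d m l, l < a → (d * (2 * a ^ 2) + a * m + l) % a = l ∧
      (d * (2 * a ^ 2) + a * m + l) / a = 2 * a * d + m := by
    intro d m l hl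
    have e : d * (2 * a ^ 2) + a * m + l = l + a * (2 * a * d + m) := by ring
    rw [e, Nat.add_mul_mod_self_left, Nat.add_mul_div_left _ _ (by omega)]
    exact ⟨Nat.mod_eq_of_lt hl, by rw [Nat.div_eq_of_lt hl, zero_add]⟩
  obtain ⟨k1, k2⟩ := key d m l hl
  obtain ⟨k1', k2'⟩ := key d' m' l' hl'
  have e : m + 2 * a * d = m' + 2 * a * d' := by
    rw [add_comm m, add_comm m', ← k2, ← k2', h]
  have em : m = m' := by
    have := congrArg (· % (2 * a)) e
    simpa [Nat.add_mul_mod_self_left, Nat.mod_eq_of_lt hm, Nat.mod_eq_of_lt hm'] using this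
  subst em
  exact ⟨Nat.eq_of_mul_eq_mul_left (show 0 < 2 * a by omega) (by omega), rfl, by
    rw [← k1, ← k1', h]⟩

open Classical in
theorem count_suzukiRep_low {a u : ℕ} (hu : u + 2 ≤ a) :
    Nat.count (SuzukiRep a) (u * (2 * a ^ 2 + 2 * a + 1) + 1) =
      ∑ d ∈ Finset.range (u + 1), (d + 1) ^ 2 := by
  let S : Finset (Σ _ : ℕ, Σ _ : ℕ, ℕ) := (Finset.range (u + 1)).sigma fun d =>
    (Finset.range (d + 1)).sigma fun l => Finset.Ico (2 * l) (2 * d + 1)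
  have hS : S.card = ∑ d ∈ Finset.range (u + 1), (d + 1) ^ 2 := by
    simp only [S, Finset.card_sigma, Nat.card_Ico, sum_range_odd]
  rw [← hS, Nat.count_eq_card_filter_range]
  symm
  refine Finset.card_bij (fun x _ => x.1 * (2 * a ^ 2) + a * x.2.2 + x.2.1) ?_ ?_ ?_
  · rintro ⟨d, l, m⟩ hx
    simp only [S, Finset.mem_sigma, Finset.mem_range, Finset.mem_Ico] at hx
    simp only [Finset.mem_filter, Finset.mem_range]
    refine ⟨?_, d, m, l, by omega, by omega, rfl⟩
    have h1 : d * (2 * a ^ 2) ≤ u * (2 * a ^ 2) := Nat.mul_le_mul_right _ (by omega)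
    have h2 : a * m ≤ a * (2 * u) := Nat.mul_le_mul_left _ (by omega)
    have h3 : l ≤ u := by omega
    nlinarith
  · rintro ⟨d, l, m⟩ hx ⟨d', l', m'⟩ hx' h
    simp only [S, Finset.mem_sigma, Finset.mem_range, Finset.mem_Ico] at hx hx'
    dsimp only at h
    obtain ⟨rfl, rfl, rfl⟩ := suzuki_digits_unique (by omega) (by omega) (by omega) (by omega) h
    rfl
  · intro s hs
    simp only [Finset.mem_filter, Finset.mem_range] at hs
    obtain ⟨hlt, d, m, l, h1, h2, rfl⟩ := hs
    have hd : d ≤ u := by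
      by_contra! hd
      have h3 : (u + 1) * (2 * a ^ 2) ≤ d * (2 * a ^ 2) := Nat.mul_le_mul_right _ hd
      nlinarith
    refine ⟨⟨d, l, m⟩, ?_, rfl⟩
    simp only [S, Finset.mem_sigma, Finset.mem_range, Finset.mem_Ico]
    omega

/-- for `q₀ ≤ t ≤ 2q₀ - 4` the number of `s ∈ H` with
`s ≤ t(q+2q₀+1)` is `t(q+2q₀+1) + 1 - g + C(2q₀-t+2,4) - C(2q₀-t,4)`. -/
theorem suzuki_count_high (n : ℕ) (hn : 2 ≤ n) (q₀ q : ℕ) (hq₀ : q₀ = 2 ^ n)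
    (hq : q = 2 * q₀ ^ 2) (H : AddSubmonoid ℕ)
    (hH : H = AddSubmonoid.closure {q, q + q₀, q + 2 * q₀, q + 2 * q₀ + 1})
    (g : ℕ) (hg : g = q₀ * (q - 1))
    (t : ℕ) (ht1 : q₀ ≤ t) (ht2 : t ≤ 2 * q₀ - 4) :
    (Set.ncard {s : ℕ | s ∈ H ∧ s ≤ t * (q + 2 * q₀ + 1)} : ℤ) =
      (t : ℤ) * (q + 2 * q₀ + 1) + 1 - g +
        ((2 * q₀ - t + 2).choose 4 : ℤ) - ((2 * q₀ - t).choose 4 : ℤ) := by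
  classical
  have h4 : 4 ≤ q₀ := hq₀ ▸ Nat.pow_le_pow_right (by norm_num : 0 < 2) hn
  clear hq₀
  obtain ⟨u, hu⟩ : ∃ u, t + u + 2 = 2 * q₀ := ⟨2 * q₀ - t - 2, by omega⟩
  subst hq hH
  have hg' : g + q₀ = 2 * q₀ ^ 3 := by
    obtain ⟨r, hr⟩ := Nat.exists_eq_succ_of_ne_zero (show 2 * q₀ ^ 2 ≠ 0 by positivity)
    rw [hg, hr, Nat.succ_sub_one]
    nlinarith
  have hlow := count_suzukiRep_low (a := q₀) (u := u) (by omega)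
  set N := 2 * q₀ ^ 2 + 2 * q₀ + 1 with hN
  clear_value N
  have hset : {s : ℕ | s ∈ AddSubmonoid.closure ({2 * q₀ ^ 2, 2 * q₀ ^ 2 + q₀,
      2 * q₀ ^ 2 + 2 * q₀, N} : Set ℕ) ∧ s ≤ t * N} =
      ((Finset.range (t * N + 1)).filter (SuzukiRep q₀) : Set ℕ) := by
    ext s
    simp only [hN, Set.mem_ofPred_eq, mem_closure_iff_suzukiRep, Finset.coe_filter,
      Finset.mem_range, Nat.lt_succ_iff, and_comm]
  rw [hset, Set.ncard_coe_finset, ← Nat.count_eq_card_filter_range]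
  have hM : t * N + 1 + (u * N + 1) = 2 * g := by
    have : (t + u + 2) * N = 2 * q₀ * N := by rw [hu]
    nlinarith
  have hP : ∀ s s', s + s' + 1 = 2 * g → (SuzukiRep q₀ s ↔ ¬ SuzukiRep q₀ s') :=
    fun s s' h => suzukiRep_iff_not (by omega) (by omega)
  have hfull := Nat.count_reflect _ (2 * g) hP (2 * g) le_rfl
  have hred := Nat.count_reflect _ (2 * g) hP (u * N + 1) (by omega)
  rw [show 2 * g - (u * N + 1) = t * N + 1 by omega, hlow] at hred
  rw [Nat.sub_self, Nat.count_zero] at hfull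
  have hsum := sum_range_succ_sq_add_choose u
  rw [show 2 * q₀ - t + 2 = u + 4 by omega, show 2 * q₀ - t = u + 2 by omega]
  have hNz : (N : ℤ) = ((2 * q₀ ^ 2 : ℕ) : ℤ) + 2 * q₀ + 1 := by rw [hN]; push_cast; ring
  rw [← hNz]
  zify at hred hfull hsum hM
  linarith
end

section
/- Let t := 2q₀−3. Then the number of elements s ∈ H with s ≤ t(q+2q₀+1) equals t(q+2q₀+1) + 6 − g, where g := q₀(q−1). -/
/-- Every element of a semigroup generated by four elements subject to the three relations `h₁`,
`h₂`, `h₃` has an expression with bounded coefficients at the last three generators. -/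
theorem exists_bounded_coeff_of_mem_closure {a w x y z : ℕ} (ha : 2 ≤ a)
    (h₁ : a * y = (a + 1) * w) (h₂ : 2 * x = w + y) (h₃ : a * z = a * w + x) {s : ℕ}
    (hs : s ∈ AddSubmonoid.closure ({w, x, y, z} : Set ℕ)) :
    ∃ i j k l : ℕ, j < a ∧ k < 2 ∧ l < a ∧ s = i * w + j * y + k * x + l * z := by
  have addy : ∀ s, (∃ i j k l : ℕ, j < a ∧ k < 2 ∧ l < a ∧ s = i * w + j * y + k * x + l * z) →
      ∃ i j k l : ℕ, j < a ∧ k < 2 ∧ l < a ∧ s + y = i * w + j * y + k * x + l * z := by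
    rintro s ⟨i, j, k, l, hj, hk, hl, rfl⟩
    by_cases h : j + 1 < a
    · exact ⟨i, j + 1, k, l, h, hk, hl, by ring⟩
    · obtain rfl : a = j + 1 := by omega
      exact ⟨i + (j + 2), 0, k, l, by omega, hk, hl, by linarith⟩
  have addw : ∀ c s, (∃ i j k l : ℕ, j < a ∧ k < 2 ∧ l < a ∧
      s = i * w + j * y + k * x + l * z) →
      ∃ i j k l : ℕ, j < a ∧ k < 2 ∧ l < a ∧ s + c * w = i * w + j * y + k * x + l * z := by
    rintro c s ⟨i, j, k, l, hj, hk, hl, rfl⟩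
    exact ⟨i + c, j, k, l, hj, hk, hl, by ring⟩
  have addx : ∀ s, (∃ i j k l : ℕ, j < a ∧ k < 2 ∧ l < a ∧ s = i * w + j * y + k * x + l * z) →
      ∃ i j k l : ℕ, j < a ∧ k < 2 ∧ l < a ∧ s + x = i * w + j * y + k * x + l * z := by
    rintro s ⟨i, j, k, l, hj, hk, hl, rfl⟩
    by_cases h : k = 0
    · exact ⟨i, j, 1, l, hj, by omega, hl, by rw [h]; ring⟩
    · obtain rfl : k = 1 := by omega
      obtain ⟨i', j', k', l', hj', hk', hl', h'⟩ :=
        addy _ (addw 1 _ ⟨i, j, 0, l, hj, by omega, hl, rfl⟩)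
      exact ⟨i', j', k', l', hj', hk', hl', by linarith⟩
  have addz : ∀ s, (∃ i j k l : ℕ, j < a ∧ k < 2 ∧ l < a ∧ s = i * w + j * y + k * x + l * z) →
      ∃ i j k l : ℕ, j < a ∧ k < 2 ∧ l < a ∧ s + z = i * w + j * y + k * x + l * z := by
    rintro s ⟨i, j, k, l, hj, hk, hl, rfl⟩
    by_cases h : l + 1 < a
    · exact ⟨i, j, k, l + 1, hj, hk, h, by ring⟩
    · obtain rfl : a = l + 1 := by omega
      obtain ⟨i', j', k', l', hj', hk', hl', h'⟩ :=
        addx _ (addw (l + 1) _ ⟨i, j, k, 0, hj, hk, by omega, rfl⟩)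
      exact ⟨i', j', k', l', hj', hk', hl', by linarith⟩
  induction hs using AddSubmonoid.closure_induction_right with
  | zero => exact ⟨0, 0, 0, 0, by omega, by omega, by omega, by simp⟩
  | add_right s _ v hv ih =>
    rcases hv with rfl | rfl | rfl | rfl
    · simpa using addw 1 _ ih
    · exact addx _ ih
    · exact addy _ ih
    · exact addz _ ih

/-- If `p` holds for exactly one of `s` and `2 * g - 1 - s`, then counting `p` below `x` and
below `2 * g - x` gives a Riemann–Roch type formula. -/
theorem Nat.count_sub_count_of_symmetric {p : ℕ → Prop} [DecidablePred p] {g : ℕ}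
    (hp : ∀ x y, x + y + 1 = 2 * g → (p x ↔ ¬ p y)) {x y : ℕ} (hxy : x + y = 2 * g) :
    (Nat.count p x : ℤ) - Nat.count p y = x - g := by
  have key : ∀ x y, x + y = 2 * g →
      (Nat.count p x : ℤ) - Nat.count p y - x = Nat.count p 0 - Nat.count p (2 * g) := by
    intro x
    induction x with
    | zero => intro y h; simp [show y = 2 * g by omega]
    | succ x ih =>
      intro y h
      rw [← ih (y + 1) (by omega), Nat.count_succ, Nat.count_succ]
      have := hp x y (by omega)
      by_cases hy : p y
      · simp [hy, this]
        ring
      · simp [hy, this]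
        ring
  have h₁ := key x y hxy
  have h₂ := key g g (by omega)
  linarith

section Suzuki

variable {a : ℕ}

theorem exists_bounded_coeff_of_mem_suzuki (ha : 2 ≤ a) {s : ℕ}
    (hs : s ∈ AddSubmonoid.closure
      ({2 * a ^ 2, 2 * a ^ 2 + a, 2 * a ^ 2 + 2 * a, 2 * a ^ 2 + 2 * a + 1} : Set ℕ)) :
    ∃ i j k l : ℕ, j < a ∧ k < 2 ∧ l < a ∧
      s = i * (2 * a ^ 2) + j * (2 * a ^ 2 + 2 * a) + k * (2 * a ^ 2 + a)
        + l * (2 * a ^ 2 + 2 * a + 1) :=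
  exists_bounded_coeff_of_mem_closure ha (by ring) (by ring) (by ring) hs

theorem mem_suzuki_of_coeff (i j k l : ℕ) :
    i * (2 * a ^ 2) + j * (2 * a ^ 2 + 2 * a) + k * (2 * a ^ 2 + a)
        + l * (2 * a ^ 2 + 2 * a + 1) ∈ AddSubmonoid.closure
      ({2 * a ^ 2, 2 * a ^ 2 + a, 2 * a ^ 2 + 2 * a, 2 * a ^ 2 + 2 * a + 1} : Set ℕ) := by
  rw [← smul_eq_mul i, ← smul_eq_mul j, ← smul_eq_mul k, ← smul_eq_mul l]
  refine add_mem (add_mem (add_mem ?_ ?_) ?_) ?_ <;>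
    exact nsmul_mem (AddSubmonoid.subset_closure (by simp)) _

/-- The Frobenius number `2 * g - 1`, with `g = a * (2 * a ^ 2 - 1)`, is a gap. -/
theorem frobenius_notMem_suzuki (ha : 2 ≤ a) {s : ℕ} (h : s + 2 * a + 1 = 4 * a ^ 3) :
    s ∉ AddSubmonoid.closure
      ({2 * a ^ 2, 2 * a ^ 2 + a, 2 * a ^ 2 + 2 * a, 2 * a ^ 2 + 2 * a + 1} : Set ℕ) := by
  intro hs
  obtain ⟨i, j, k, l, hj, hk, hl, rfl⟩ := exists_bounded_coeff_of_mem_suzuki ha hs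
  have ha0 : (a : ℤ) ≠ 0 := by omega
  zify at h
  have hl' : (l : ℤ) = a - 1 := by
    have : (a : ℤ) ∣ l + 1 := ⟨4 * a ^ 2 - 2 - i * (2 * a) - j * (2 * a + 2) - k * (2 * a + 1)
      - l * (2 * a + 2), by linear_combination h⟩
    have := Int.le_of_dvd (by omega) this
    omega
  rw [hl'] at h
  have h₁ : (i : ℤ) * (2 * a) + j * (2 * a + 2) + k * (2 * a + 1) = 2 * a ^ 2 - 1 :=
    mul_left_cancel₀ ha0 (by linear_combination h)
  have hk' : k = 1 := by
    by_contra hk1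
    obtain rfl : k = 0 := by omega
    have : (2 : ℤ) ∣ 1 := ⟨a ^ 2 - i * a - j * (a + 1), by linear_combination h₁⟩
    omega
  subst hk'
  have hj' : (j : ℤ) = a - 1 := by
    have : (a : ℤ) ∣ j + 1 := ⟨a - 1 - i - j, by push_cast at h₁; linarith⟩
    have := Int.le_of_dvd (by omega) this
    omega
  rw [hj'] at h₁
  have : (i : ℤ) + 1 = 0 := mul_left_cancel₀ ha0 (by push_cast at h₁; linarith)
  omega

theorem mem_suzuki_iff_notMem (ha : 2 ≤ a) {s s' : ℕ} (h : s + s' + 2 * a + 1 = 4 * a ^ 3) :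
    s ∈ AddSubmonoid.closure
      ({2 * a ^ 2, 2 * a ^ 2 + a, 2 * a ^ 2 + 2 * a, 2 * a ^ 2 + 2 * a + 1} : Set ℕ) ↔
    s' ∉ AddSubmonoid.closure
      ({2 * a ^ 2, 2 * a ^ 2 + a, 2 * a ^ 2 + 2 * a, 2 * a ^ 2 + 2 * a + 1} : Set ℕ) := by
  refine ⟨fun hs hs' => frobenius_notMem_suzuki ha h (add_mem hs hs'), fun hs' => ?_⟩
  by_contra hs
  have hd : ∀ u v : ℤ, 0 < v → ∃ c d : ℤ, 0 ≤ d ∧ d < v ∧ u = v * c + d := fun u v hv =>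
    ⟨u / v, u % v, Int.emod_nonneg _ hv.ne', Int.emod_lt_of_pos _ hv,
      (Int.mul_ediv_add_emod u v).symm⟩
  obtain ⟨c, l, hl0, hl, hc⟩ := hd s a (by omega)
  obtain ⟨d, k, hk0, hk, hd'⟩ := hd (c - l * (2 * a + 2)) 2 (by omega)
  obtain ⟨i, j, hj0, hj, hi⟩ := hd (d - k * a) a (by omega)
  have hs_eq : (s : ℤ) = (i - j) * (2 * a ^ 2) + j * (2 * a ^ 2 + 2 * a) + k * (2 * a ^ 2 + a)
      + l * (2 * a ^ 2 + 2 * a + 1) := by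
    linear_combination hc + a * hd' + 2 * a * hi
  obtain hI | hI := le_or_gt 0 (i - j)
  · apply hs
    convert mem_suzuki_of_coeff (i - j).toNat j.toNat k.toNat l.toNat
    zify
    simpa only [Int.toNat_of_nonneg, hI, hj0, hk0, hl0] using hs_eq
  · apply hs'
    convert mem_suzuki_of_coeff (-1 - (i - j)).toNat (a - 1 - j).toNat (1 - k).toNat
      (a - 1 - l).toNat
    zify at h ⊢
    rw [Int.toNat_of_nonneg (by omega), Int.toNat_of_nonneg (by omega),
      Int.toNat_of_nonneg (by omega), Int.toNat_of_nonneg (by omega)]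
    linear_combination h - hs_eq

theorem count_suzuki [DecidablePred (· ∈ AddSubmonoid.closure
      ({2 * a ^ 2, 2 * a ^ 2 + a, 2 * a ^ 2 + 2 * a, 2 * a ^ 2 + 2 * a + 1} : Set ℕ))]
    (ha : 2 ≤ a) :
    Nat.count (· ∈ AddSubmonoid.closure
      ({2 * a ^ 2, 2 * a ^ 2 + a, 2 * a ^ 2 + 2 * a, 2 * a ^ 2 + 2 * a + 1} : Set ℕ))
      (2 * a ^ 2 + 2 * a + 2) = 5 := by
  have hq : 2 * a + 1 < 2 * a ^ 2 := by nlinarith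
  have : (Finset.range (2 * a ^ 2 + 2 * a + 2)).filter (· ∈ AddSubmonoid.closure
      ({2 * a ^ 2, 2 * a ^ 2 + a, 2 * a ^ 2 + 2 * a, 2 * a ^ 2 + 2 * a + 1} : Set ℕ)) =
      {0, 2 * a ^ 2, 2 * a ^ 2 + a, 2 * a ^ 2 + 2 * a, 2 * a ^ 2 + 2 * a + 1} := by
    ext s
    simp only [Finset.mem_filter, Finset.mem_range, Finset.mem_insert, Finset.mem_singleton]
    constructor
    · rintro ⟨hlt, hs⟩
      obtain ⟨i, j, k, l, -, -, -, rfl⟩ := exists_bounded_coeff_of_mem_suzuki ha hs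
      have hsum : i + j + k + l < 2 := by
        by_contra! h
        nlinarith [Nat.mul_le_mul_right (2 * a ^ 2) h, Nat.zero_le (j * a), Nat.zero_le (k * a),
          Nat.zero_le (l * a)]
      obtain ⟨rfl, rfl, rfl, rfl⟩ | ⟨rfl, rfl, rfl, rfl⟩ | ⟨rfl, rfl, rfl, rfl⟩ |
          ⟨rfl, rfl, rfl, rfl⟩ | ⟨rfl, rfl, rfl, rfl⟩ :
          (i = 0 ∧ j = 0 ∧ k = 0 ∧ l = 0) ∨ (i = 1 ∧ j = 0 ∧ k = 0 ∧ l = 0) ∨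
          (i = 0 ∧ j = 1 ∧ k = 0 ∧ l = 0) ∨ (i = 0 ∧ j = 0 ∧ k = 1 ∧ l = 0) ∨
          (i = 0 ∧ j = 0 ∧ k = 0 ∧ l = 1) := by omega
      all_goals simp
    · rintro (rfl | rfl | rfl | rfl | rfl)
      · exact ⟨by omega, zero_mem _⟩
      all_goals exact ⟨by omega, AddSubmonoid.subset_closure (by simp)⟩
  rw [Nat.count_eq_card_filter_range, this]
  repeat rw [Finset.card_insert_of_notMem
    (by simp only [Finset.mem_insert, Finset.mem_singleton]; omega)]
  simp

end Suzuki

/-- for `t = 2q₀ - 3` the number of `s ∈ H` with `s ≤ t(q+2q₀+1)`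
is `t(q+2q₀+1) + 6 - g`. -/
theorem suzuki_count_t_eq (n : ℕ) (hn : 2 ≤ n) (q₀ q : ℕ) (hq₀ : q₀ = 2 ^ n)
    (hq : q = 2 * q₀ ^ 2) (H : AddSubmonoid ℕ)
    (hH : H = AddSubmonoid.closure {q, q + q₀, q + 2 * q₀, q + 2 * q₀ + 1})
    (g : ℕ) (hg : g = q₀ * (q - 1)) (t : ℕ) (ht : t = 2 * q₀ - 3) :
    (Set.ncard {s : ℕ | s ∈ H ∧ s ≤ t * (q + 2 * q₀ + 1)} : ℤ) =
      (t : ℤ) * (q + 2 * q₀ + 1) + 6 - g := by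
  classical
  have ha : 2 ≤ q₀ := hq₀ ▸ hn.trans n.lt_two_pow_self.le
  have hg' : g + q₀ = 2 * q₀ ^ 3 := by
    obtain ⟨r, hr⟩ : ∃ r, q = r + 1 := ⟨q - 1, by have := pow_pos (show 0 < q₀ by omega) 2; omega⟩
    rw [hg, hr, Nat.add_sub_cancel, show 2 * q₀ ^ 3 = q₀ * q by rw [hq]; ring, hr]
    ring
  have ht' : t + 3 = 2 * q₀ := by omega
  subst hq hH
  have hset : {s : ℕ | s ∈ AddSubmonoid.closure
      ({2 * q₀ ^ 2, 2 * q₀ ^ 2 + q₀, 2 * q₀ ^ 2 + 2 * q₀, 2 * q₀ ^ 2 + 2 * q₀ + 1} : Set ℕ) ∧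
      s ≤ t * (2 * q₀ ^ 2 + 2 * q₀ + 1)} =
      (Finset.range (t * (2 * q₀ ^ 2 + 2 * q₀ + 1) + 1)).filter (· ∈ AddSubmonoid.closure
      ({2 * q₀ ^ 2, 2 * q₀ ^ 2 + q₀, 2 * q₀ ^ 2 + 2 * q₀, 2 * q₀ ^ 2 + 2 * q₀ + 1} : Set ℕ)) := by
    ext s
    simp [and_comm]
  have hN : t * (2 * q₀ ^ 2 + 2 * q₀ + 1) + 1 + (2 * q₀ ^ 2 + 2 * q₀ + 2) = 2 * g := by
    zify at hg' ht' ⊢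
    linear_combination (2 * (q₀ : ℤ) ^ 2 + 2 * q₀ + 1) * ht' - 2 * hg'
  have key := Nat.count_sub_count_of_symmetric
    (fun x y h => mem_suzuki_iff_notMem ha (s := x) (s' := y) (by omega)) hN
  rw [count_suzuki ha, Nat.count_eq_card_filter_range] at key
  rw [hset, Set.ncard_coe_finset]
  push_cast at key ⊢
  linarith
end

section
/- Let t := 2q₀−2. Then the number of elements s ∈ H with s ≤ t(q+2q₀+1) equals t(q+2q₀+1) + 2 − g, where g := q₀(q−1). -/
/-- `s = a q + b (q + 2k) + c (q + k) + d (q + 2k + 1)` with `q = 2k²`, in normal form: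
`0 ≤ b < k`, `0 ≤ c < 2` and `0 ≤ d < k`. -/
def IsSuzukiNormalForm (k s a b c d : ℤ) : Prop :=
  s = a * (2 * k ^ 2) + b * (2 * k ^ 2 + 2 * k) + c * (2 * k ^ 2 + k)
      + d * (2 * k ^ 2 + 2 * k + 1) ∧
    (0 ≤ b ∧ b < k) ∧ (0 ≤ c ∧ c < 2) ∧ (0 ≤ d ∧ d < k)

namespace IsSuzukiNormalForm

theorem exists_of_pos {k : ℤ} (hk : 0 < k) (s : ℤ) :
    ∃ a b c d, IsSuzukiNormalForm k s a b c d := by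
  have h₁ := Int.emod_add_mul_ediv s k
  set d := s % k with hd
  set u := s / k - d * (2 * k + 2) with hu
  have h₂ := Int.emod_add_mul_ediv u 2
  set c := u % 2 with hc
  set v := u / 2 - c * k with hv
  have h₃ := Int.emod_add_mul_ediv v k
  set b := v % k with hb
  refine ⟨v / k - b, b, c, d, ?_, ⟨Int.emod_nonneg _ hk.ne', Int.emod_lt_of_pos _ hk⟩,
    ⟨Int.emod_nonneg _ (by norm_num), Int.emod_lt_of_pos _ (by norm_num)⟩,
    ⟨Int.emod_nonneg _ hk.ne', Int.emod_lt_of_pos _ hk⟩⟩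
  linear_combination -h₁ - k * hu - k * h₂ - 2 * k * hv - 2 * k * h₃

theorem coeff_unique {k s a b c d a' b' c' d' : ℤ} (hk : 0 < k)
    (h : IsSuzukiNormalForm k s a b c d) (h' : IsSuzukiNormalForm k s a' b' c' d') :
    a = a' := by
  obtain ⟨hs, ⟨hb₀, hb₁⟩, ⟨hc₀, hc₁⟩, ⟨hd₀, hd₁⟩⟩ := h
  obtain ⟨hs', ⟨hb₀', hb₁'⟩, ⟨hc₀', hc₁'⟩, ⟨hd₀', hd₁'⟩⟩ := h'
  have hd : d - d' = 0 := Int.eq_zero_of_abs_lt_dvd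
    (m := k) ⟨(a' - a) * (2 * k) + (b' - b) * (2 * k + 2) + (c' - c) * (2 * k + 1)
      + (d' - d) * (2 * k + 2), by linear_combination hs' - hs⟩
    (abs_lt.2 ⟨by linarith, by linarith⟩)
  obtain rfl : d = d' := sub_eq_zero.1 hd
  have hc_eq : (a - a') * (2 * k) + (b - b') * (2 * k + 2) + (c - c') * (2 * k + 1) = 0 :=
    mul_left_cancel₀ hk.ne' (by linear_combination hs' - hs)
  have hc : c - c' = 0 := Int.eq_zero_of_abs_lt_dvd
    (m := 2) ⟨(a' - a) * k + (b' - b) * (k + 1) + (c' - c) * k, by linear_combination hc_eq⟩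
    (abs_lt.2 ⟨by linarith, by linarith⟩)
  obtain rfl : c = c' := sub_eq_zero.1 hc
  have hb_eq : (a - a') * k + (b - b') * (k + 1) = 0 := by linarith
  have hb : b - b' = 0 := Int.eq_zero_of_abs_lt_dvd
    (m := k) ⟨(a' - a) + (b' - b), by linear_combination hb_eq⟩
    (abs_lt.2 ⟨by linarith, by linarith⟩)
  obtain rfl : b = b' := sub_eq_zero.1 hb
  have : (a - a') * k = 0 := by linear_combination hb_eq
  exact sub_eq_zero.1 ((mul_eq_zero.1 this).resolve_right hk.ne')

/-- The reflection `s ↦ 2g - 1 - s`, where `g = k (2k² - 1)`. -/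
theorem reflect {k s a b c d : ℤ} (h : IsSuzukiNormalForm k s a b c d) :
    IsSuzukiNormalForm k (2 * (k * (2 * k ^ 2 - 1)) - 1 - s)
      (-1 - a) (k - 1 - b) (1 - c) (k - 1 - d) := by
  obtain ⟨hs, ⟨hb₀, hb₁⟩, ⟨hc₀, hc₁⟩, ⟨hd₀, hd₁⟩⟩ := h
  refine ⟨?_, ?_, ?_, ?_⟩
  · rw [hs]; ring
  all_goals constructor <;> linarith

end IsSuzukiNormalForm

/-- `s` has a normal form with nonnegative leading coefficient. -/
def HasNonnegSuzukiForm (k s : ℤ) : Prop :=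
  ∃ a b c d, 0 ≤ a ∧ IsSuzukiNormalForm k s a b c d

namespace HasNonnegSuzukiForm

variable {k s : ℤ}

theorem zero (hk : 0 < k) : HasNonnegSuzukiForm k 0 :=
  ⟨0, 0, 0, 0, le_rfl, by ring, ⟨le_rfl, hk⟩, ⟨le_rfl, by norm_num⟩, ⟨le_rfl, hk⟩⟩

theorem add_mul_q (h : HasNonnegSuzukiForm k s) {x : ℤ} (hx : 0 ≤ x) :
    HasNonnegSuzukiForm k (x * (2 * k ^ 2) + s) := by
  obtain ⟨a, b, c, d, ha, hs, h⟩ := h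
  exact ⟨a + x, b, c, d, by positivity, by rw [hs]; ring, h⟩

theorem add_q_add_two_mul (hk : 0 < k) (h : HasNonnegSuzukiForm k s) :
    HasNonnegSuzukiForm k (2 * k ^ 2 + 2 * k + s) := by
  obtain ⟨a, b, c, d, ha, hs, ⟨hb₀, hb₁⟩, h⟩ := h
  by_cases hb : b + 1 < k
  · exact ⟨a, b + 1, c, d, ha, by rw [hs]; ring, ⟨by positivity, hb⟩, h⟩
  · obtain rfl : b = k - 1 := by linarith
    exact ⟨a + (k + 1), 0, c, d, by positivity, by rw [hs]; ring, ⟨le_rfl, hk⟩, h⟩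

theorem add_q_add (hk : 0 < k) (h : HasNonnegSuzukiForm k s) :
    HasNonnegSuzukiForm k (2 * k ^ 2 + k + s) := by
  obtain ⟨a, b, c, d, ha, hs, hb, ⟨hc₀, hc₁⟩, hd⟩ := h
  obtain rfl | rfl : c = 0 ∨ c = 1 := by omega
  · exact ⟨a, b, 1, d, ha, by rw [hs]; ring, hb, by norm_num, hd⟩
  · have h₀ : HasNonnegSuzukiForm k (s - (2 * k ^ 2 + k)) :=
      ⟨a, b, 0, d, ha, by rw [hs]; ring, hb, by norm_num, hd⟩
    convert (h₀.add_q_add_two_mul hk).add_mul_q zero_le_one using 1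
    ring

theorem add_q_add_two_mul_add_one (hk : 0 < k) (h : HasNonnegSuzukiForm k s) :
    HasNonnegSuzukiForm k (2 * k ^ 2 + 2 * k + 1 + s) := by
  obtain ⟨a, b, c, d, ha, hs, hb, hc, ⟨hd₀, hd₁⟩⟩ := h
  by_cases hd : d + 1 < k
  · exact ⟨a, b, c, d + 1, ha, by rw [hs]; ring, hb, hc, ⟨by positivity, hd⟩⟩
  · obtain rfl : d = k - 1 := by linarith
    have h₀ : HasNonnegSuzukiForm k (s - (k - 1) * (2 * k ^ 2 + 2 * k + 1)) :=
      ⟨a, b, c, 0, ha, by rw [hs]; ring, hb, hc, ⟨le_rfl, hk⟩⟩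
    convert (h₀.add_q_add hk).add_mul_q hk.le using 1
    ring

end HasNonnegSuzukiForm

/-- The Suzuki semigroup consists of the elements with nonnegative leading coefficient. -/
theorem mem_suzukiSemigroup_iff {k : ℕ} (hk : 0 < k) (s : ℕ) :
    s ∈ AddSubmonoid.closure
      ({2 * k ^ 2, 2 * k ^ 2 + k, 2 * k ^ 2 + 2 * k, 2 * k ^ 2 + 2 * k + 1} : Set ℕ) ↔
      HasNonnegSuzukiForm k s := by
  have hk' : (0 : ℤ) < k := by exact_mod_cast hk
  constructor
  · intro h
    induction h using AddSubmonoid.closure_induction_left with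
    | zero => exact_mod_cast HasNonnegSuzukiForm.zero hk'
    | add_left x hx y hy ih =>
      rcases hx with rfl | rfl | rfl | rfl
      · simpa using ih.add_mul_q zero_le_one
      · simpa using ih.add_q_add hk'
      · simpa using ih.add_q_add_two_mul hk'
      · simpa using ih.add_q_add_two_mul_add_one hk'
  · rintro ⟨a, b, c, d, ha, hs, ⟨hb, -⟩, ⟨hc, -⟩, ⟨hd, -⟩⟩
    lift a to ℕ using ha
    lift b to ℕ using hb
    lift c to ℕ using hc
    lift d to ℕ using hd
    have hs' : s = a • (2 * k ^ 2) + b • (2 * k ^ 2 + 2 * k) + c • (2 * k ^ 2 + k)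
        + d • (2 * k ^ 2 + 2 * k + 1) := by
      simp only [smul_eq_mul]; exact_mod_cast hs
    rw [hs']
    refine add_mem (add_mem (add_mem ?_ ?_) ?_) ?_ <;>
      exact nsmul_mem (AddSubmonoid.subset_closure (by simp)) _

/-- The Suzuki semigroup is symmetric: `s ↦ 2g - 1 - s` exchanges elements and gaps. -/
theorem hasNonnegSuzukiForm_reflect_iff {k : ℤ} (hk : 0 < k) (s : ℤ) :
    HasNonnegSuzukiForm k (2 * (k * (2 * k ^ 2 - 1)) - 1 - s) ↔ ¬ HasNonnegSuzukiForm k s := by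
  obtain ⟨a, b, c, d, h⟩ := IsSuzukiNormalForm.exists_of_pos hk s
  constructor
  · rintro ⟨a₁, b₁, c₁, d₁, ha₁, h₁⟩ ⟨a₂, b₂, c₂, d₂, ha₂, h₂⟩
    have := h₁.coeff_unique hk h₂.reflect
    linarith
  · intro hs
    have ha : a < 0 := not_le.1 fun ha => hs ⟨a, b, c, d, ha, h⟩
    exact ⟨_, _, _, _, by linarith, h.reflect⟩

open Finset in
/-- A predicate exchanged with its negation by the reflection of `[0, 2g)` holds for exactly
half of that interval. -/
theorem card_filter_range_two_mul_of_reflect (g : ℕ) (p : ℕ → Prop) [DecidablePred p]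
    (h : ∀ s < 2 * g, p (2 * g - 1 - s) ↔ ¬ p s) : #{s ∈ range (2 * g) | p s} = g := by
  have h₁ : #{s ∈ range (2 * g) | p s} = #{s ∈ range (2 * g) | ¬ p s} := by
    refine card_bij' (fun s _ => 2 * g - 1 - s) (fun s _ => 2 * g - 1 - s) ?_ ?_ ?_ ?_ <;>
      simp only [mem_filter, mem_range] <;> rintro s ⟨hs, hps⟩
    · exact ⟨by omega, by rw [h s hs]; exact not_not.2 hps⟩
    · exact ⟨by omega, (h s hs).2 hps⟩
    all_goals omega
  have h₂ : #{s ∈ range (2 * g) | p s} + #{s ∈ range (2 * g) | ¬ p s} = 2 * g := by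
    rw [card_filter_add_card_filter_not, card_range]
  omega

/-- for `t = 2q₀ - 2` the number of `s ∈ H` with `s ≤ t(q+2q₀+1)`
is `t(q+2q₀+1) + 2 - g`. -/
theorem suzuki_count_t_eq' (n : ℕ) (hn : 2 ≤ n) (q₀ q : ℕ) (hq₀ : q₀ = 2 ^ n)
    (hq : q = 2 * q₀ ^ 2) (H : AddSubmonoid ℕ)
    (hH : H = AddSubmonoid.closure {q, q + q₀, q + 2 * q₀, q + 2 * q₀ + 1})
    (g : ℕ) (hg : g = q₀ * (q - 1)) (t : ℕ) (ht : t = 2 * q₀ - 2) :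
    (Set.ncard {s : ℕ | s ∈ H ∧ s ≤ t * (q + 2 * q₀ + 1)} : ℤ) =
      (t : ℤ) * (q + 2 * q₀ + 1) + 2 - g := by
  classical
  have hk : 0 < q₀ := hq₀ ▸ by positivity
  have hk' : (0 : ℤ) < q₀ := by exact_mod_cast hk
  have hq1 : 1 ≤ q := by rw [hq]; exact Nat.mul_pos two_pos (pow_pos hk 2)
  have htz : (t : ℤ) = 2 * q₀ - 2 := by omega
  have hgz : (g : ℤ) = q₀ * (2 * q₀ ^ 2 - 1) := by
    rw [hg, Nat.cast_mul, Nat.cast_sub hq1, hq]; push_cast; ring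
  have hqz : (q : ℤ) = 2 * q₀ ^ 2 := by exact_mod_cast hq
  have htop : (t : ℤ) * (q + 2 * q₀ + 1) = 2 * g - 2 := by
    rw [htz, hgz, hqz]; ring
  have htopN : t * (q + 2 * q₀ + 1) + 2 = 2 * g := by
    zify; linarith
  have hmem : ∀ s : ℕ, s ∈ H ↔ HasNonnegSuzukiForm q₀ s := by
    intro s; rw [hH, hq]; exact mem_suzukiSemigroup_iff hk s
  have hrefl : ∀ s < 2 * g, 2 * g - 1 - s ∈ H ↔ s ∉ H := by
    intro s hs
    rw [hmem, hmem, ← hasNonnegSuzukiForm_reflect_iff hk', ← hgz]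
    have : ((2 * g - 1 - s : ℕ) : ℤ) = 2 * g - 1 - s := by omega
    rw [this]
  have hlast : 2 * g - 1 ∉ H := fun h => (hrefl 0 (by omega)).1 (by simpa using h) H.zero_mem
  have hset : {s : ℕ | s ∈ H ∧ s ≤ t * (q + 2 * q₀ + 1)} =
      ((Finset.range (2 * g)).filter (· ∈ H) : Finset ℕ) := by
    ext s
    simp only [Set.mem_ofPred_eq, Finset.coe_filter, Finset.mem_range]
    constructor
    · rintro ⟨hs, hle⟩
      exact ⟨by omega, hs⟩
    · rintro ⟨hlt, hs⟩
      have : s ≠ 2 * g - 1 := fun h => hlast (h ▸ hs)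
      exact ⟨hs, by omega⟩
  rw [hset, Set.ncard_coe_finset, card_filter_range_two_mul_of_reflect g (· ∈ H) hrefl, htop]
  ring
end

section
/- Let t be an integer with t ≥ 2q₀−1. Then the number of elements s ∈ H with s ≤ t(q+2q₀+1) equals t(q+2q₀+1) + 1 − g, where g := q₀(q−1). -/
/-- The natural number `c * (2 * a ^ 2) + 2 * a * u + a * k + l`, in mixed-radix form. -/
def mixedRadix (a c u k l : ℕ) : ℕ := ((c * a + u) * 2 + k) * a + l

/-- The least leading digit `c` for which `mixedRadix a c u k l` lies in the Suzuki semigroup. -/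
def aperyDigit (a u k l : ℕ) : ℕ := u + k + if l ≤ u then 0 else a + 1

theorem mul_add_inj_of_lt {b x y x' y' : ℕ} (hy : y < b) (hy' : y' < b)
    (h : x * b + y = x' * b + y') : x = x' ∧ y = y' := by
  have hb : 0 < b := by omega
  have h1 := congrArg (· / b) h
  have h2 := congrArg (· % b) h
  simp only [Nat.mul_add_mod', Nat.mod_eq_of_lt hy, Nat.mod_eq_of_lt hy'] at h2
  simp only [mul_comm _ b, Nat.mul_add_div hb, Nat.div_eq_of_lt hy, Nat.div_eq_of_lt hy'] at h1
  omega

theorem mixedRadix_inj {a c u k l c' u' k' l' : ℕ} (hu : u < a) (hk : k < 2) (hl : l < a)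
    (hu' : u' < a) (hk' : k' < 2) (hl' : l' < a)
    (h : mixedRadix a c u k l = mixedRadix a c' u' k' l') :
    c = c' ∧ u = u' ∧ k = k' ∧ l = l' := by
  obtain ⟨h1, rfl⟩ := mul_add_inj_of_lt hl hl' h
  obtain ⟨h2, rfl⟩ := mul_add_inj_of_lt hk hk' h1
  obtain ⟨rfl, rfl⟩ := mul_add_inj_of_lt hu hu' h2
  simp

theorem exists_eq_mixedRadix {a : ℕ} (ha : 0 < a) (m : ℕ) :
    ∃ c u k l, u < a ∧ k < 2 ∧ l < a ∧ m = mixedRadix a c u k l := by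
  refine ⟨m / a / 2 / a, m / a / 2 % a, m / a % 2, m % a, Nat.mod_lt _ ha,
    Nat.mod_lt _ two_pos, Nat.mod_lt _ ha, ?_⟩
  simp only [mixedRadix, Nat.div_add_mod']

/-- Every element of the Suzuki semigroup has a leading digit at least the Apéry digit. -/
theorem exists_digits_of_mem_closure {a m : ℕ} (ha : 2 ≤ a)
    (hm : m ∈ AddSubmonoid.closure
      {2 * a ^ 2, 2 * a ^ 2 + a, 2 * a ^ 2 + 2 * a, 2 * a ^ 2 + 2 * a + 1}) :
    ∃ c u k l, u < a ∧ k < 2 ∧ l < a ∧ aperyDigit a u k l ≤ c ∧ m = mixedRadix a c u k l := by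
  induction hm using AddSubmonoid.closure_induction_left with
  | zero => exact ⟨0, 0, 0, 0, by omega, by omega, by omega, by simp [aperyDigit],
      by simp [mixedRadix]⟩
  | add_left x hx y hy ih =>
    obtain ⟨c, u, k, l, hu, hk, hl, hc, rfl⟩ := ih
    simp only [aperyDigit] at hc
    simp only [Set.mem_insert_iff, Set.mem_singleton_iff] at hx
    simp only [aperyDigit, mixedRadix]
    rcases hx with rfl | rfl | rfl | rfl
    · exact ⟨c + 1, u, k, l, hu, hk, hl, by omega, by ring⟩
    · obtain rfl | rfl : k = 0 ∨ k = 1 := by omega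
      · exact ⟨c + 1, u, 1, l, hu, by omega, hl, by split_ifs at * <;> omega, by ring⟩
      · obtain h | h : u + 1 < a ∨ a = u + 1 := by omega
        · exact ⟨c + 1, u + 1, 0, l, h, by omega, hl, by split_ifs at * <;> omega, by ring⟩
        · exact ⟨c + 2, 0, 0, l, by omega, by omega, hl, by split_ifs at * <;> omega,
            by subst h; ring⟩
    · obtain h | h : u + 1 < a ∨ a = u + 1 := by omega
      · exact ⟨c + 1, u + 1, k, l, h, by omega, hl, by split_ifs at * <;> omega, by ring⟩
      · exact ⟨c + 2, 0, k, l, by omega, by omega, hl, by split_ifs at * <;> omega,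
          by subst h; ring⟩
    · obtain h' | h' : l + 1 < a ∨ a = l + 1 := by omega
      · obtain h | h : u + 1 < a ∨ a = u + 1 := by omega
        · exact ⟨c + 1, u + 1, k, l + 1, h, by omega, h', by split_ifs at * <;> omega, by ring⟩
        · exact ⟨c + 2, 0, k, l + 1, by omega, by omega, h', by split_ifs at * <;> omega,
            by subst h; ring⟩
      · obtain rfl | rfl : k = 0 ∨ k = 1 := by omega
        · obtain h | h : u + 1 < a ∨ u = l := by omega
          · exact ⟨c + 1, u + 1, 1, 0, h, by omega, by omega, by split_ifs at * <;> omega,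
              by subst h'; ring⟩
          · exact ⟨c + 2, 0, 1, 0, by omega, by omega, by omega, by split_ifs at * <;> omega,
              by subst h' h; ring⟩
        · obtain h | h | h : u + 2 < a ∨ l = u + 1 ∨ u = l := by omega
          · exact ⟨c + 1, u + 2, 0, 0, h, by omega, by omega, by split_ifs at * <;> omega,
              by subst h'; ring⟩
          · exact ⟨c + 2, 0, 0, 0, by omega, by omega, by omega, by split_ifs at * <;> omega,
              by subst h' h; ring⟩
          · exact ⟨c + 2, 1, 0, 0, by omega, by omega, by omega, by split_ifs at * <;> omega,
              by subst h' h; ring⟩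

theorem mixedRadix_mem_closure {a c u k l : ℕ} (hl : l < a) (hc : aperyDigit a u k l ≤ c) :
    mixedRadix a c u k l ∈ AddSubmonoid.closure
      {2 * a ^ 2, 2 * a ^ 2 + a, 2 * a ^ 2 + 2 * a, 2 * a ^ 2 + 2 * a + 1} := by
  have key (x y z w : ℕ) : x * (2 * a ^ 2) + y * (2 * a ^ 2 + 2 * a) + z * (2 * a ^ 2 + a)
      + w * (2 * a ^ 2 + 2 * a + 1) ∈ AddSubmonoid.closure
      {2 * a ^ 2, 2 * a ^ 2 + a, 2 * a ^ 2 + 2 * a, 2 * a ^ 2 + 2 * a + 1} := by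
    simp only [← smul_eq_mul x, ← smul_eq_mul y, ← smul_eq_mul z, ← smul_eq_mul w]
    refine add_mem (add_mem (add_mem ?_ ?_) ?_) ?_ <;>
      exact nsmul_mem (AddSubmonoid.subset_closure (by simp)) _
  simp only [aperyDigit] at hc
  split_ifs at hc with h
  · obtain ⟨x, rfl⟩ := Nat.exists_eq_add_of_le hc
    obtain ⟨y, rfl⟩ := Nat.exists_eq_add_of_le h
    convert key x y k l using 1
    simp only [mixedRadix]
    ring
  · obtain ⟨x, rfl⟩ := Nat.exists_eq_add_of_le hc
    obtain ⟨y, hy⟩ := Nat.exists_eq_add_of_le hl.le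
    convert key x (u + y) k l using 1
    simp only [mixedRadix]
    subst hy
    ring

/-- Digit expansions of the gaps of the Suzuki semigroup, as tuples `((u, k, l), c)`. -/
def gapDigits (a : ℕ) : Finset (Σ _ : ℕ × ℕ × ℕ, ℕ) :=
  (Finset.range a ×ˢ Finset.range 2 ×ˢ Finset.range a).sigma
    fun p => Finset.range (aperyDigit a p.1 p.2.1 p.2.2)

/-- The gaps of the Suzuki semigroup. -/
def gapSet (a : ℕ) : Finset ℕ :=
  (gapDigits a).image fun p => mixedRadix a p.2 p.1.1 p.1.2.1 p.1.2.2

theorem mem_gapSet {a m : ℕ} : m ∈ gapSet a ↔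
    ∃ c u k l, u < a ∧ k < 2 ∧ l < a ∧ c < aperyDigit a u k l ∧ m = mixedRadix a c u k l := by
  simp only [gapSet, gapDigits, Finset.mem_image, Finset.mem_sigma, Finset.mem_product,
    Finset.mem_range]
  constructor
  · rintro ⟨⟨⟨u, k, l⟩, c⟩, ⟨⟨hu, hk, hl⟩, hc⟩, rfl⟩
    exact ⟨c, u, k, l, hu, hk, hl, hc, rfl⟩
  · rintro ⟨c, u, k, l, hu, hk, hl, hc, rfl⟩
    exact ⟨⟨⟨u, k, l⟩, c⟩, ⟨⟨hu, hk, hl⟩, hc⟩, rfl⟩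

theorem mem_closure_iff_notMem_gapSet {a m : ℕ} (ha : 2 ≤ a) :
    m ∈ AddSubmonoid.closure
      {2 * a ^ 2, 2 * a ^ 2 + a, 2 * a ^ 2 + 2 * a, 2 * a ^ 2 + 2 * a + 1} ↔ m ∉ gapSet a := by
  rw [mem_gapSet]
  constructor
  · rintro hm ⟨c, u, k, l, hu, hk, hl, hc, rfl⟩
    obtain ⟨c', u', k', l', hu', hk', hl', hc', h⟩ := exists_digits_of_mem_closure ha hm
    obtain ⟨rfl, rfl, rfl, rfl⟩ := mixedRadix_inj hu hk hl hu' hk' hl' h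
    omega
  · intro hm
    obtain ⟨c, u, k, l, hu, hk, hl, rfl⟩ := exists_eq_mixedRadix (by omega : 0 < a) m
    refine mixedRadix_mem_closure hl (le_of_not_gt fun hc => hm ?_)
    exact ⟨c, u, k, l, hu, hk, hl, hc, rfl⟩

theorem lt_of_mem_gapSet {a m : ℕ} (hm : m ∈ gapSet a) : m < (2 * a + 1) * (2 * a ^ 2) := by
  obtain ⟨c, u, k, l, hu, hk, hl, hc, rfl⟩ := mem_gapSet.1 hm
  have hc' : c ≤ 2 * a := by
    simp only [aperyDigit] at hc
    split_ifs at hc <;> omega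
  have h1 : c * a + u + 1 ≤ (2 * a + 1) * a := by nlinarith
  have h2 : (c * a + u) * 2 + k + 1 ≤ (2 * a + 1) * a * 2 := by omega
  simp only [mixedRadix]
  nlinarith

theorem sum_aperyDigit {a u k : ℕ} (hu : u < a) :
    (∑ l ∈ Finset.range a, (aperyDigit a u k l : ℤ)) = a * (u + k) + (a - 1 - u) * (a + 1) := by
  obtain ⟨b, rfl⟩ := Nat.exists_eq_add_of_le (Nat.succ_le_of_lt hu)
  have h : ∀ l ∈ Finset.range (u + 1), aperyDigit (u + 1 + b) u k l = u + k := fun l hl => by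
    simp [aperyDigit, Nat.lt_succ_iff.1 (Finset.mem_range.1 hl)]
  have h' : ∀ l, aperyDigit (u + 1 + b) u k (u + 1 + l) = u + k + (u + 1 + b + 1) := fun l => by
    simp [aperyDigit, show ¬ u + 1 + l ≤ u by omega]
  rw [← Nat.cast_sum, Finset.sum_range_add, Finset.sum_congr rfl h]
  simp only [Nat.succ_eq_add_one, h', Finset.sum_const, Finset.card_range, smul_eq_mul]
  push_cast
  ring

theorem card_gapSet (a : ℕ) : ((gapSet a).card : ℤ) = a * (2 * a ^ 2 - 1) := by
  have hinj : Set.InjOn (fun p : Σ _ : ℕ × ℕ × ℕ, ℕ => mixedRadix a p.2 p.1.1 p.1.2.1 p.1.2.2)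
      (gapDigits a) := by
    rintro ⟨⟨u, k, l⟩, c⟩ hp ⟨⟨u', k', l'⟩, c'⟩ hp' h
    simp only [gapDigits, Finset.mem_coe, Finset.mem_sigma, Finset.mem_product,
      Finset.mem_range] at hp hp'
    obtain ⟨rfl, rfl, rfl, rfl⟩ :=
      mixedRadix_inj hp.1.1 hp.1.2.1 hp.1.2.2 hp'.1.1 hp'.1.2.1 hp'.1.2.2 h
    rfl
  have hsum : ∀ m : ℕ, (∑ u ∈ Finset.range m, (a + 2 * (a ^ 2 - 1) - 2 * u : ℤ))
      = m * (a + 2 * (a ^ 2 - 1)) - m * (m - 1) := by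
    intro m
    induction m with
    | zero => simp
    | succ m ih => rw [Finset.sum_range_succ, ih]; push_cast; ring
  rw [gapSet, Finset.card_image_of_injOn hinj, gapDigits, Finset.card_sigma]
  simp only [Finset.card_range, Finset.sum_product]
  push_cast
  rw [Finset.sum_congr rfl (g := fun u : ℕ => (a + 2 * (a ^ 2 - 1) - 2 * u : ℤ)), hsum]
  · ring
  · intro u hu
    rw [Finset.sum_range_succ, Finset.sum_range_one, sum_aperyDigit (Finset.mem_range.1 hu),
      sum_aperyDigit (Finset.mem_range.1 hu)]
    push_cast
    ring

/-- for `t ≥ 2q₀ - 1` the number of `s ∈ H` with `s ≤ t(q+2q₀+1)`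
is `t(q+2q₀+1) + 1 - g`. -/
theorem suzuki_count_large (n : ℕ) (hn : 2 ≤ n) (q₀ q : ℕ) (hq₀ : q₀ = 2 ^ n)
    (hq : q = 2 * q₀ ^ 2) (H : AddSubmonoid ℕ)
    (hH : H = AddSubmonoid.closure {q, q + q₀, q + 2 * q₀, q + 2 * q₀ + 1})
    (g : ℕ) (hg : g = q₀ * (q - 1)) (t : ℕ) (ht : 2 * q₀ - 1 ≤ t) :
    (Set.ncard {s : ℕ | s ∈ H ∧ s ≤ t * (q + 2 * q₀ + 1)} : ℤ) =
      (t : ℤ) * (q + 2 * q₀ + 1) + 1 - g := by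
  have ha : 2 ≤ q₀ := hq₀ ▸ le_self_pow₀ (n := n) (by norm_num : 1 ≤ 2) (by omega)
  clear hq₀
  subst hq hH
  have hbound : (2 * q₀ + 1) * (2 * q₀ ^ 2) ≤ t * (2 * q₀ ^ 2 + 2 * q₀ + 1) + 1 := by
    have h := Nat.mul_le_mul_right (2 * q₀ ^ 2 + 2 * q₀ + 1) ht
    zify [show 1 ≤ 2 * q₀ by omega] at h ⊢
    linarith
  have hsub : gapSet q₀ ⊆ Finset.range (t * (2 * q₀ ^ 2 + 2 * q₀ + 1) + 1) := fun m hm =>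
    Finset.mem_range.2 ((lt_of_mem_gapSet hm).trans_le hbound)
  have hset : {s : ℕ | s ∈ AddSubmonoid.closure {2 * q₀ ^ 2, 2 * q₀ ^ 2 + q₀,
      2 * q₀ ^ 2 + 2 * q₀, 2 * q₀ ^ 2 + 2 * q₀ + 1} ∧ s ≤ t * (2 * q₀ ^ 2 + 2 * q₀ + 1)} =
      ↑(Finset.range (t * (2 * q₀ ^ 2 + 2 * q₀ + 1) + 1) \ gapSet q₀) := by
    ext s
    simp only [Set.mem_ofPred_eq, mem_closure_iff_notMem_gapSet ha, Finset.coe_sdiff,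
      Set.mem_sdiff, Finset.mem_coe, Finset.mem_range, Nat.lt_succ_iff]
    exact and_comm
  rw [hset, Set.ncard_coe_finset, Finset.cast_card_sdiff hsub, card_gapSet, Finset.card_range, hg]
  have hpos : 1 ≤ 2 * q₀ ^ 2 := by nlinarith
  push_cast [hpos]
  ring
end

section
/- Let t be an integer with t ≥ 2q₀+1. Then for every element s ∈ H with s ≤ t(q+2q₀+1), there exists a 4-tuple (a,b,c,d) of non-negative integers such that ‖(a,b,c,d)‖ = s and a+b+c+d ≤ t. -/
/-- With `q = 2 * m ^ 2`, every integer in `[t * q + q, t * (q + 2 * m + 1)]` is a sum of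
at most `t` elements of `{q, q + m, q + 2 * m, q + 2 * m + 1}`. -/
theorem exists_rep_of_le {m q t s : ℕ} (hm : 0 < m) (hq : q = 2 * m ^ 2)
    (hlow : t * q + q ≤ s) (hup : s ≤ t * (q + 2 * m + 1)) :
    ∃ a b c d : ℕ,
      a * q + b * (q + m) + c * (q + 2 * m) + d * (q + 2 * m + 1) = s ∧
      a + b + c + d ≤ t := by
  obtain ⟨e, rfl⟩ := Nat.exists_eq_add_of_le (le_of_add_le_left hlow)
  have he : 2 * m ^ 2 ≤ e := by omega
  have he' : e ≤ t * (2 * m) + t := by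
    have : t * (q + 2 * m + 1) = t * q + (t * (2 * m) + t) := by ring
    omega
  obtain ⟨x, d, hxd, hdx, hxt⟩ : ∃ x d : ℕ, m * x + d = e ∧ 2 * d ≤ x ∧ x ≤ 2 * t := by
    by_cases h : e / m ≤ 2 * t
    · refine ⟨e / m, e % m, Nat.div_add_mod e m, ?_, h⟩
      have hmod := Nat.mod_lt e hm
      have : 2 * m ≤ e / m := (Nat.le_div_iff_mul_le hm).2 (by nlinarith)
      omega
    · have h2 : 2 * t * m ≤ e := (Nat.le_div_iff_mul_le hm).1 (by omega)
      have h3 : m * (2 * t) = 2 * t * m := by ring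
      have h4 : t * (2 * m) = 2 * t * m := by ring
      exact ⟨2 * t, e - 2 * t * m, by omega, by omega, le_rfl⟩
  obtain ⟨c, hc⟩ : ∃ c, x / 2 = c + d := ⟨x / 2 - d, by omega⟩
  obtain ⟨a, ha⟩ : ∃ a, t = a + x % 2 + c + d := ⟨t - (x % 2 + c + d), by omega⟩
  refine ⟨a, x % 2, c, d, ?_, ha.ge⟩
  have hx : x = x % 2 + 2 * (c + d) := by omega
  generalize x % 2 = b at hx ha
  subst hx ha hxd
  ring

/-- Elements of the additive submonoid of `ℕ` generated by four numbers are their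
combinations with natural number coefficients. -/
theorem exists_eq_of_mem_closure_four {u v w z s : ℕ}
    (hs : s ∈ AddSubmonoid.closure ({u, v, w, z} : Set ℕ)) :
    ∃ a b c d : ℕ, a * u + b * v + c * w + d * z = s := by
  induction hs using AddSubmonoid.closure_induction with
  | mem x hx =>
    rcases hx with rfl | rfl | rfl | rfl
    · exact ⟨1, 0, 0, 0, by ring⟩
    · exact ⟨0, 1, 0, 0, by ring⟩
    · exact ⟨0, 0, 1, 0, by ring⟩
    · exact ⟨0, 0, 0, 1, by ring⟩
  | zero => exact ⟨0, 0, 0, 0, by ring⟩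
  | add x y _ _ hx hy =>
    obtain ⟨a, b, c, d, rfl⟩ := hx
    obtain ⟨a', b', c', d', rfl⟩ := hy
    exact ⟨a + a', b + b', c + c', d + d', by ring⟩


/-- for `t ≥ 2q₀ + 1` every `s ∈ H` with `s ≤ t(q+2q₀+1)` can be
written as `‖(a,b,c,d)‖` with `a+b+c+d ≤ t`. -/
theorem suzuki_rep_bounded (n : ℕ) (hn : 2 ≤ n) (q₀ q : ℕ) (hq₀ : q₀ = 2 ^ n)
    (hq : q = 2 * q₀ ^ 2) (H : AddSubmonoid ℕ)
    (hH : H = AddSubmonoid.closure {q, q + q₀, q + 2 * q₀, q + 2 * q₀ + 1})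
    (t : ℕ) (ht : 2 * q₀ + 1 ≤ t) :
    ∀ s : ℕ, s ∈ H → s ≤ t * (q + 2 * q₀ + 1) →
      ∃ a b c d : ℕ,
        a * q + b * (q + q₀) + c * (q + 2 * q₀) + d * (q + 2 * q₀ + 1) = s ∧
        a + b + c + d ≤ t := by
  intro s hs hst
  subst hH
  obtain ⟨a, b, c, d, habcd⟩ := exists_eq_of_mem_closure_four hs
  by_cases hk : a + b + c + d ≤ t
  · exact ⟨a, b, c, d, habcd, hk⟩
  · refine exists_rep_of_le (hq₀ ▸ by positivity) hq ?_ hst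
    calc t * q + q = (t + 1) * q := by ring
      _ ≤ (a + b + c + d) * q := Nat.mul_le_mul_right q (by omega)
      _ = a * q + b * q + c * q + d * q := by ring
      _ ≤ a * q + b * (q + q₀) + c * (q + 2 * q₀) + d * (q + 2 * q₀ + 1) := by
        gcongr <;> omega
      _ = s := habcd
end

section
/- Let (a,b,c,d) be a 4-tuple of non-negative integers with ‖(a,b,c,d)‖ ≤ q₀(q+2q₀+1). Then either a+b+c+d ≤ q₀, or (a,b,c,d) = (q₀+1,0,0,0), or (a,b,c,d) = (q₀,1,0,0). -/
/-- if `‖(a,b,c,d)‖ ≤ q₀(q+2q₀+1)` then either `a+b+c+d ≤ q₀`, or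
`(a,b,c,d) = (q₀+1,0,0,0)`, or `(a,b,c,d) = (q₀,1,0,0)`. -/
theorem suzuki_exceptional_tuples (n : ℕ) (hn : 2 ≤ n) (q₀ q : ℕ)
    (hq₀ : q₀ = 2 ^ n) (hq : q = 2 * q₀ ^ 2) (a b c d : ℕ)
    (h : a * q + b * (q + q₀) + c * (q + 2 * q₀) + d * (q + 2 * q₀ + 1) ≤
      q₀ * (q + 2 * q₀ + 1)) :
    a + b + c + d ≤ q₀ ∨
    (a, b, c, d) = (q₀ + 1, 0, 0, 0) ∨
    (a, b, c, d) = (q₀, 1, 0, 0) := by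
  have hpos : 0 < q₀ := hq₀ ▸ Nat.two_pow_pos n
  have hlt : q₀ < q := by nlinarith
  have hweight : (a + b + c + d) * q + (b * q₀ + 2 * c * q₀ + d * (2 * q₀ + 1)) ≤
      (q₀ + 1) * q + q₀ := by
    nlinarith
  rcases le_or_gt (a + b + c + d) q₀ with hs | hs
  · exact Or.inl hs
  have hsum : a + b + c + d = q₀ + 1 := by
    by_contra hne
    have hge : q₀ + 2 ≤ a + b + c + d := by omega
    nlinarith [Nat.mul_le_mul_right q hge]
  rw [hsum] at hweight
  have hrest : b * q₀ + 2 * c * q₀ + d * (2 * q₀ + 1) ≤ q₀ := by omega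
  have hb : b ≤ 1 := by
    by_contra hb
    nlinarith [Nat.mul_le_mul_right q₀ (not_le.mp hb)]
  have hc : c = 0 := by
    by_contra hc
    nlinarith [Nat.mul_le_mul_right q₀ (Nat.pos_of_ne_zero hc)]
  have hd : d = 0 := by
    by_contra hd
    nlinarith [Nat.mul_le_mul_right (2 * q₀ + 1) (Nat.pos_of_ne_zero hd)]
  simp only [Prod.mk.injEq]
  omega
end

section
/- The smallest positive integer m such that both m ∈ H and m−1 ∈ H is m = q+2q₀+1. (Equivalently, q+2q₀ ∈ H and q+2q₀+1 ∈ H, while for every positive integer m < q+2q₀+1 at least one of m, m−1 fails to lie in H.) -/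
/-- Below `q + 2 * q₀ + 1`, the semigroup has only `0` and its first three generators. -/
theorem mem_suzuki_semigroup_cases {q₀ q x : ℕ} (hq : 2 * q₀ + 1 ≤ q)
    (hx : x ∈ AddSubmonoid.closure {q, q + q₀, q + 2 * q₀, q + 2 * q₀ + 1}) :
    x = 0 ∨ x = q ∨ x = q + q₀ ∨ x = q + 2 * q₀ ∨ q + 2 * q₀ + 1 ≤ x := by
  induction hx using AddSubmonoid.closure_induction with
  | mem x hx =>
    simp only [Set.mem_insert_iff, Set.mem_singleton_iff] at hx
    omega
  | zero => exact Or.inl rfl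
  | add x y _ _ hx hy => omega

/-- `q+2q₀+1` is the smallest positive integer `m` such that both
`m ∈ H` and `m - 1 ∈ H`. -/
theorem suzuki_least_very_ample (n : ℕ) (hn : 2 ≤ n) (q₀ q : ℕ)
    (hq₀ : q₀ = 2 ^ n) (hq : q = 2 * q₀ ^ 2) (H : AddSubmonoid ℕ)
    (hH : H = AddSubmonoid.closure {q, q + q₀, q + 2 * q₀, q + 2 * q₀ + 1}) :
    IsLeast {m : ℕ | 0 < m ∧ m ∈ H ∧ m - 1 ∈ H} (q + 2 * q₀ + 1) := by
  have h4 : 4 ≤ q₀ := by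
    rw [hq₀]
    exact Nat.pow_le_pow_right (n := 2) (by norm_num) hn
  have hle : 2 * q₀ + 1 ≤ q := by nlinarith
  subst hH
  refine ⟨⟨Nat.succ_pos _, AddSubmonoid.subset_closure (by simp),
    AddSubmonoid.subset_closure (by simp)⟩, ?_⟩
  rintro m ⟨hpos, hm, hm'⟩
  have := mem_suzuki_semigroup_cases hle hm
  have := mem_suzuki_semigroup_cases hle hm'
  omega
end

section
/- The number of non-negative integers that do not belong to H equals g := q₀(q−1); that is, the numerical semigroup H has exactly q₀(q−1) gaps, matching the genus of the Suzuki curve. -/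
/-- The non-members of the semigroup generated by `2 * s`, `2 * s + 1`, `2 * s + 2`. -/
def intervalGaps (s : ℕ) : Finset ℕ :=
  (Finset.range s).biUnion fun k => Finset.Ioo (2 * s * k + 2 * k) (2 * s * (k + 1))

theorem notMem_intervalGaps_iff {s : ℕ} (hs : 0 < s) (t : ℕ) :
    t ∉ intervalGaps s ↔ ∃ k e, e ≤ 2 * k ∧ t = 2 * s * k + e := by
  simp only [intervalGaps, Finset.mem_biUnion, Finset.mem_range, Finset.mem_Ioo]
  constructor
  · intro h
    refine ⟨t / (2 * s), t % (2 * s), ?_, (Nat.div_add_mod t (2 * s)).symm⟩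
    by_contra! hlt
    have hmod : t % (2 * s) < 2 * s := Nat.mod_lt _ (by lia)
    have hdm := Nat.div_add_mod t (2 * s)
    exact h ⟨t / (2 * s), by lia, by lia, by rw [mul_add]; lia⟩
  · rintro ⟨k, e, he, rfl⟩ ⟨j, -, h₁, h₂⟩
    have hkj : k < j + 1 := lt_of_mul_lt_mul_left (by lia : 2 * s * k < 2 * s * (j + 1)) (by lia)
    have := Nat.mul_le_mul_left (2 * s) (Nat.le_of_lt_succ hkj)
    lia

theorem card_intervalGaps (s : ℕ) : (intervalGaps s).card = s ^ 2 := by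
  rw [intervalGaps, Finset.card_biUnion]
  · have hsum : ∀ m ≤ s, ∑ k ∈ Finset.range m,
        (Finset.Ioo (2 * s * k + 2 * k) (2 * s * (k + 1))).card + m * m = 2 * s * m := by
      intro m hm
      induction m with
      | zero => simp
      | succ m ih =>
        have := ih (by lia)
        rw [Finset.sum_range_succ, Nat.card_Ioo]
        have : 2 * s * (m + 1) - (2 * s * m + 2 * m) - 1 = 2 * s - 2 * m - 1 := by
          rw [mul_add]; lia
        rw [this]
        have : 2 * s - 2 * m - 1 + (2 * m + 1) = 2 * s := by lia
        linarith
    have := hsum s le_rfl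
    nlinarith
  · intro j _ k _ hjk
    rw [Function.onFun, Finset.disjoint_left]
    intro t hj hk
    simp only [Finset.mem_Ioo] at hj hk
    apply hjk
    have h₁ : j < k + 1 :=
      lt_of_mul_lt_mul_left (by lia : 2 * s * j < 2 * s * (k + 1)) (by lia)
    have h₂ : k < j + 1 :=
      lt_of_mul_lt_mul_left (by lia : 2 * s * k < 2 * s * (j + 1)) (by lia)
    lia

theorem mem_suzuki_closure_iff (s m : ℕ) :
    m ∈ AddSubmonoid.closure ({2 * s ^ 2, 2 * s ^ 2 + s, 2 * s ^ 2 + 2 * s,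
      2 * s ^ 2 + 2 * s + 1} : Set ℕ) ↔
    ∃ k e d, e ≤ 2 * k ∧ m = s * (2 * s * k + e) + d * (2 * s ^ 2 + 2 * s + 1) := by
  constructor
  · intro hm
    induction hm using AddSubmonoid.closure_induction with
    | mem x hx =>
      simp only [Set.mem_insert_iff, Set.mem_singleton_iff] at hx
      rcases hx with rfl | rfl | rfl | rfl
      · exact ⟨1, 0, 0, by lia, by ring⟩
      · exact ⟨1, 1, 0, by lia, by ring⟩
      · exact ⟨1, 2, 0, by lia, by ring⟩
      · exact ⟨0, 0, 1, by lia, by ring⟩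
    | zero => exact ⟨0, 0, 0, by lia, by ring⟩
    | add x y _ _ hx hy =>
      obtain ⟨k, e, d, h, rfl⟩ := hx
      obtain ⟨k', e', d', h', rfl⟩ := hy
      exact ⟨k + k', e + e', d + d', by lia, by ring⟩
  · rintro ⟨k, e, d, h, rfl⟩
    obtain ⟨a, b, c, rfl, rfl⟩ : ∃ a b c, k = a + b + c ∧ e = b + 2 * c :=
      ⟨k - e % 2 - e / 2, e % 2, e / 2, by lia, by lia⟩
    have hgen : ∀ x ∈ ({2 * s ^ 2, 2 * s ^ 2 + s, 2 * s ^ 2 + 2 * s,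
        2 * s ^ 2 + 2 * s + 1} : Set ℕ), ∀ i : ℕ, i • x ∈ AddSubmonoid.closure
        ({2 * s ^ 2, 2 * s ^ 2 + s, 2 * s ^ 2 + 2 * s, 2 * s ^ 2 + 2 * s + 1} : Set ℕ) :=
      fun x hx i => nsmul_mem (AddSubmonoid.subset_closure hx) i
    convert add_mem (add_mem (add_mem (hgen (2 * s ^ 2) (by simp) a)
      (hgen (2 * s ^ 2 + s) (by simp) b)) (hgen (2 * s ^ 2 + 2 * s) (by simp) c))
      (hgen (2 * s ^ 2 + 2 * s + 1) (by simp) d) using 1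
    simp only [smul_eq_mul]
    ring

theorem mul_add_mem_suzuki_closure_iff {s r : ℕ} (hr : r < s) (u : ℕ) :
    s * u + r ∈ AddSubmonoid.closure ({2 * s ^ 2, 2 * s ^ 2 + s, 2 * s ^ 2 + 2 * s,
      2 * s ^ 2 + 2 * s + 1} : Set ℕ) ↔
    ∃ t ∉ intervalGaps s, u = t + r * (2 * s + 2) := by
  have hs : 0 < s := by lia
  simp only [notMem_intervalGaps_iff hs]
  rw [mem_suzuki_closure_iff]
  constructor
  · rintro ⟨k, e, d, he, h⟩
    have hmod : d % s = r := by
      have h' : s * u + r = s * (2 * s * k + e + d * (2 * s + 2)) + d := by rw [h]; ring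
      have := congrArg (· % s) h'
      simpa [Nat.mul_add_mod, Nat.mod_eq_of_lt hr] using this.symm
    have hd := Nat.mod_add_div d s
    rw [hmod] at hd
    refine ⟨_, ⟨k + d / s * (s + 1), e + d / s, by nlinarith [Nat.zero_le (d / s * s)], rfl⟩, ?_⟩
    apply Nat.eq_of_mul_eq_mul_left hs
    apply Nat.add_right_cancel (m := r)
    rw [h]
    nth_rewrite 1 [← hd]
    ring
  · rintro ⟨t, ⟨k, e, he, rfl⟩, rfl⟩
    exact ⟨k, e, r, he, by ring⟩

/-- The quotients by `s` of the gaps congruent to `r` modulo `s`. -/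
def suzukiGapQuotients (s r : ℕ) : Finset ℕ :=
  Finset.range (r * (2 * s + 2)) ∪ (intervalGaps s).image (· + r * (2 * s + 2))

theorem card_suzukiGapQuotients (s r : ℕ) :
    (suzukiGapQuotients s r).card = r * (2 * s + 2) + s ^ 2 := by
  rw [suzukiGapQuotients, Finset.card_union_of_disjoint, Finset.card_range,
    Finset.card_image_of_injective _ (add_left_injective _), card_intervalGaps]
  rw [Finset.disjoint_left]
  simp only [Finset.mem_range, Finset.mem_image, not_exists, not_and]
  lia

theorem mem_suzukiGapQuotients_iff {s r : ℕ} (hr : r < s) (u : ℕ) :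
    u ∈ suzukiGapQuotients s r ↔ s * u + r ∉ AddSubmonoid.closure
      ({2 * s ^ 2, 2 * s ^ 2 + s, 2 * s ^ 2 + 2 * s, 2 * s ^ 2 + 2 * s + 1} : Set ℕ) := by
  rw [mul_add_mem_suzuki_closure_iff hr]
  simp only [suzukiGapQuotients, Finset.mem_union, Finset.mem_range, Finset.mem_image]
  constructor
  · rintro (h | ⟨t, ht, rfl⟩) ⟨t', ht', h'⟩
    · lia
    · exact ht' (by rwa [← Nat.add_right_cancel h'])
  · intro h
    by_contra! hu
    have hle := hu.1
    exact h ⟨u - r * (2 * s + 2), fun hmem => hu.2 _ hmem (by lia), by lia⟩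

theorem ncard_compl_suzuki_closure {s : ℕ} (hs : 0 < s) :
    Set.ncard {m : ℕ | m ∉ AddSubmonoid.closure ({2 * s ^ 2, 2 * s ^ 2 + s, 2 * s ^ 2 + 2 * s,
      2 * s ^ 2 + 2 * s + 1} : Set ℕ)} = s * (2 * s ^ 2 - 1) := by
  have hset : {m : ℕ | m ∉ AddSubmonoid.closure ({2 * s ^ 2, 2 * s ^ 2 + s, 2 * s ^ 2 + 2 * s,
      2 * s ^ 2 + 2 * s + 1} : Set ℕ)} = ((Finset.range s).biUnion fun r =>
        (suzukiGapQuotients s r).image (s * · + r) : Finset ℕ) := by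
    ext m
    simp only [Set.mem_ofPred_eq, Finset.mem_coe, Finset.mem_biUnion, Finset.mem_range,
      Finset.mem_image]
    constructor
    · intro hm
      have hr := Nat.mod_lt m hs
      refine ⟨m % s, hr, m / s, ?_, Nat.div_add_mod m s⟩
      rwa [mem_suzukiGapQuotients_iff hr, Nat.div_add_mod]
    · rintro ⟨r, hr, u, hu, rfl⟩
      exact (mem_suzukiGapQuotients_iff hr u).1 hu
  rw [hset, Set.ncard_coe_finset, Finset.card_biUnion]
  · have hcard : ∀ r ∈ Finset.range s, ((suzukiGapQuotients s r).image (s * · + r)).card =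
        r * (2 * s + 2) + s ^ 2 := by
      intro r _
      rw [Finset.card_image_of_injective, card_suzukiGapQuotients]
      intro u v h
      exact Nat.eq_of_mul_eq_mul_left hs (Nat.add_right_cancel h)
    rw [Finset.sum_congr rfl hcard, Finset.sum_add_distrib, ← Finset.sum_mul]
    have hgauss := Finset.sum_range_id_mul_two s
    obtain ⟨p, rfl⟩ : ∃ p, s = p + 1 := ⟨s - 1, by lia⟩
    have hsub : 2 * (p + 1) ^ 2 - 1 = 2 * p ^ 2 + 4 * p + 1 := by
      have : 2 * (p + 1) ^ 2 = 2 * p ^ 2 + 4 * p + 1 + 1 := by ring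
      lia
    rw [hsub, show 2 * (p + 1) + 2 = 2 * (p + 2) by ring, ← mul_assoc, hgauss]
    simp only [Finset.sum_const, Finset.card_range, smul_eq_mul, Nat.add_sub_cancel]
    ring
  · intro r hr r' hr' hne
    simp only [Finset.coe_range, Set.mem_Iio] at hr hr'
    rw [Function.onFun, Finset.disjoint_left]
    simp only [Finset.mem_image]
    rintro _ ⟨u, -, rfl⟩ ⟨v, -, h⟩
    apply hne
    have := congrArg (· % s) h
    simpa [Nat.mul_add_mod, Nat.mod_eq_of_lt hr, Nat.mod_eq_of_lt hr'] using this.symm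


/-- the numerical semigroup `H` has exactly `g = q₀(q-1)` gaps. -/
theorem suzuki_genus_gaps (n : ℕ) (hn : 2 ≤ n) (q₀ q : ℕ) (hq₀ : q₀ = 2 ^ n)
    (hq : q = 2 * q₀ ^ 2) (H : AddSubmonoid ℕ)
    (hH : H = AddSubmonoid.closure {q, q + q₀, q + 2 * q₀, q + 2 * q₀ + 1})
    (g : ℕ) (hg : g = q₀ * (q - 1)) :
    Set.ncard {m : ℕ | m ∉ H} = g := by
  subst hg hH hq hq₀
  exact ncard_compl_suzuki_closure (by positivity)
end

section
/- The integer 2q₀(q−1) − 1 does not belong to H, and every integer m ≥ 2q₀(q−1) belongs to H; that is, the Frobenius number of the numerical semigroup H is 2g − 1 = 2(q₀−1)(q+2q₀+1) + 1, where g := q₀(q−1). -/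
/-- The elements of the semigroup generated by `q, q + s, q + 2s, q + 2s + 1` are the numbers
`q N + s t + d` with `2 d ≤ t ≤ 2 N`. -/
theorem mem_closure_suzuki_generators_iff (q s m : ℕ) :
    m ∈ AddSubmonoid.closure ({q, q + s, q + 2 * s, q + 2 * s + 1} : Set ℕ) ↔
      ∃ N t d : ℕ, 2 * d ≤ t ∧ t ≤ 2 * N ∧ m = q * N + s * t + d := by
  constructor
  · intro h
    induction h using AddSubmonoid.closure_induction with
    | mem x hx =>
      simp only [Set.mem_insert_iff, Set.mem_singleton_iff] at hx
      rcases hx with rfl | rfl | rfl | rfl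
      · exact ⟨1, 0, 0, by norm_num, by norm_num, by ring⟩
      · exact ⟨1, 1, 0, by norm_num, by norm_num, by ring⟩
      · exact ⟨1, 2, 0, by norm_num, by norm_num, by ring⟩
      · exact ⟨1, 2, 1, by norm_num, by norm_num, by ring⟩
    | zero => exact ⟨0, 0, 0, by norm_num, by norm_num, by ring⟩
    | add x y _ _ hx hy =>
      obtain ⟨N, t, d, h₁, h₂, rfl⟩ := hx
      obtain ⟨N', t', d', h₁', h₂', rfl⟩ := hy
      exact ⟨N + N', t + t', d + d', by omega, by omega, by ring⟩
  · rintro ⟨N, t, d, h₁, h₂, rfl⟩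
    obtain ⟨a, b, c, rfl, rfl⟩ :
        ∃ a b c : ℕ, N = a + b + c + d ∧ t = b + 2 * c + 2 * d :=
      ⟨N - (t - 2 * d) % 2 - (t - 2 * d) / 2 - d, (t - 2 * d) % 2, (t - 2 * d) / 2,
        by omega, by omega⟩
    have key : q * (a + b + c + d) + s * (b + 2 * c + 2 * d) + d =
        a • q + b • (q + s) + c • (q + 2 * s) + d • (q + 2 * s + 1) := by
      simp only [smul_eq_mul]
      ring
    rw [key]
    refine add_mem (add_mem (add_mem ?_ ?_) ?_) ?_ <;>
      exact nsmul_mem (AddSubmonoid.subset_closure (by simp)) _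

theorem exists_suzuki_representation {s m : ℕ} (hs : 1 ≤ s) (hm : 4 * s ^ 3 ≤ m + 2 * s) :
    ∃ N t d : ℕ, 2 * d ≤ t ∧ t ≤ 2 * N ∧ m = 2 * s ^ 2 * N + s * t + d := by
  obtain ⟨M, d, hd, rfl⟩ : ∃ M d, d < s ∧ m = s * M + d :=
    ⟨m / s, m % s, Nat.mod_lt _ hs, (Nat.div_add_mod m s).symm⟩
  obtain ⟨N, t, ht, rfl⟩ : ∃ N t, t < 2 * s ∧ M = 2 * s * N + t :=
    ⟨M / (2 * s), M % (2 * s), Nat.mod_lt _ (by omega), (Nat.div_add_mod M (2 * s)).symm⟩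
  have hM : 4 * s ^ 2 < 2 * s * N + t + 3 := by
    refine lt_of_mul_lt_mul_left (a := s) ?_ (Nat.zero_le s)
    nlinarith
  have hN : 2 * s ≤ N + 1 := by
    by_contra! h
    nlinarith [Nat.mul_le_mul_left (2 * s) (show N + 2 ≤ 2 * s by omega)]
  by_cases htd : 2 * d ≤ t
  · exact ⟨N, t, d, htd, by omega, by ring⟩
  · have hN' : 2 * s ≤ N := by
      by_contra! h
      have : N + 1 = 2 * s := by omega
      nlinarith
    obtain ⟨N, rfl⟩ : ∃ N', N = N' + 1 := ⟨N - 1, by omega⟩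
    exact ⟨N, t + 2 * s, d, by omega, by omega, by ring⟩

theorem not_exists_suzuki_representation {s m : ℕ} (hs : 1 ≤ s)
    (hm : m + 1 + 2 * s = 4 * s ^ 3) :
    ¬ ∃ N t d : ℕ, 2 * d ≤ t ∧ t ≤ 2 * N ∧ m = 2 * s ^ 2 * N + s * t + d := by
  rintro ⟨N, t, d, h₁, h₂, rfl⟩
  have hdvd : s ∣ d + 1 := by
    have h : s ∣ s * (2 * s * N + t + 2) + (d + 1) := ⟨4 * s ^ 2, by linarith⟩
    exact (Nat.dvd_add_right (dvd_mul_right s _)).1 h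
  obtain ⟨K, hK⟩ := hdvd
  have hK₀ : 1 ≤ K := by
    rcases Nat.eq_zero_or_pos K with rfl | h
    · simp at hK
    · exact h
  have hM : 2 * s * N + t + K + 2 = 4 * s ^ 2 := by
    refine Nat.eq_of_mul_eq_mul_left hs ?_
    linarith
  zify at *
  obtain ⟨j, hj⟩ : ∃ j : ℤ, (N : ℤ) = 2 * s - 1 - j := ⟨2 * s - 1 - N, by ring⟩
  rw [hj] at hM h₂
  have hKj : (K : ℤ) ≤ j := by
    by_contra! h
    nlinarith [mul_le_mul_of_nonneg_left (show j + 1 ≤ (K : ℤ) by omega)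
      (show (0 : ℤ) ≤ 2 * s by omega)]
  nlinarith

/-- `2q₀(q-1) - 1 ∉ H` and every `m ≥ 2q₀(q-1)` lies in `H`;
i.e. the Frobenius number of `H` is `2g - 1 = 2(q₀-1)(q+2q₀+1) + 1`. -/
theorem suzuki_frobenius (n : ℕ) (hn : 2 ≤ n) (q₀ q : ℕ) (hq₀ : q₀ = 2 ^ n)
    (hq : q = 2 * q₀ ^ 2) (H : AddSubmonoid ℕ)
    (hH : H = AddSubmonoid.closure {q, q + q₀, q + 2 * q₀, q + 2 * q₀ + 1})
    (g : ℕ) (hg : g = q₀ * (q - 1)) :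
    (2 * q₀ * (q - 1) - 1) ∉ H ∧
    (∀ m : ℕ, 2 * q₀ * (q - 1) ≤ m → m ∈ H) ∧
    2 * g - 1 = 2 * (q₀ - 1) * (q + 2 * q₀ + 1) + 1 := by
  have hs : 1 ≤ q₀ := hq₀ ▸ Nat.one_le_two_pow
  have hq₁ : 2 ≤ q := by nlinarith
  have hconductor : 2 * q₀ * (q - 1) + 2 * q₀ = 4 * q₀ ^ 3 := by
    obtain ⟨r, hr⟩ : ∃ r, q = r + 1 := ⟨q - 1, by omega⟩
    rw [hr, Nat.add_sub_cancel]
    calc 2 * q₀ * r + 2 * q₀ = 2 * q₀ * (r + 1) := by ring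
      _ = 4 * q₀ ^ 3 := by rw [← hr, hq]; ring
  have hpos : 0 < 2 * q₀ * (q - 1) := Nat.mul_pos (by omega) (by omega)
  subst hH
  refine ⟨?_, fun m hm => ?_, ?_⟩
  · rw [mem_closure_suzuki_generators_iff, hq]
    exact not_exists_suzuki_representation hs (by rw [← hq]; omega)
  · rw [mem_closure_suzuki_generators_iff, hq]
    exact exists_suzuki_representation hs (by omega)
  · have hg₂ : 2 * g = 2 * q₀ * (q - 1) := by rw [hg]; ring
    obtain ⟨r, rfl⟩ : ∃ r, q₀ = r + 1 := ⟨q₀ - 1, by omega⟩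
    have : 2 * r * (q + 2 * (r + 1) + 1) + 2 + 2 * (r + 1) = 4 * (r + 1) ^ 3 := by
      rw [hq]; ring
    rw [Nat.add_sub_cancel]
    omega
end

section
/- The numerical semigroup H is symmetric: for every integer s with 0 ≤ s ≤ 2g−1, where g := q₀(q−1), one has s ∈ H if and only if 2g−1−s ∉ H. -/
/-- The integer combination of the generators of the Suzuki semigroup, with `r = q₀`, `q = 2 r²`. -/
def suzukiComb (r a b c e : ℤ) : ℤ :=
  a * (2 * r ^ 2) + b * (2 * r ^ 2 + 2 * r) + c * (2 * r ^ 2 + r) + e * (2 * r ^ 2 + 2 * r + 1)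

/-- Every combination can be rewritten with bounded last three coefficients, without decreasing
the first one. -/
theorem suzukiComb_normalize {r : ℕ} (hr : 0 < r) (a : ℤ) (b c e : ℕ) :
    ∃ a' : ℤ, ∃ b' c' e' : ℕ, a ≤ a' ∧ b' < r ∧ c' < 2 ∧ e' < r ∧
      suzukiComb r a b c e = suzukiComb r a' b' c' e' := by
  set c₁ := c + e / r with hc₁
  set b₁ := b + c₁ / 2 with hb₁
  refine ⟨a + (r * (e / r : ℕ) + (c₁ / 2 : ℕ) + (r + 1) * (b₁ / r : ℕ)), b₁ % r, c₁ % 2, e % r,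
    le_add_of_nonneg_right (by positivity), Nat.mod_lt _ hr, Nat.mod_lt _ two_pos,
    Nat.mod_lt _ hr, ?_⟩
  have he : ((e % r : ℕ) : ℤ) = e - r * (e / r : ℕ) := by
    rw [eq_sub_iff_add_eq]; exact_mod_cast Nat.mod_add_div e r
  have hc : ((c₁ % 2 : ℕ) : ℤ) = c + (e / r : ℕ) - 2 * (c₁ / 2 : ℕ) := by
    rw [eq_sub_iff_add_eq]; exact_mod_cast Nat.mod_add_div c₁ 2
  have hb : ((b₁ % r : ℕ) : ℤ) = b + (c₁ / 2 : ℕ) - r * (b₁ / r : ℕ) := by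
    rw [eq_sub_iff_add_eq]; exact_mod_cast Nat.mod_add_div b₁ r
  rw [he, hc, hb]
  unfold suzukiComb
  ring

theorem exists_eq_suzukiComb {r : ℕ} (hr : 0 < r) (x : ℕ) :
    ∃ a : ℤ, ∃ b c e : ℕ, b < r ∧ c < 2 ∧ e < r ∧ (x : ℤ) = suzukiComb r a b c e := by
  obtain ⟨a, b, c, e, -, hb, hc, he, h⟩ :=
    suzukiComb_normalize hr (-(x * (r + 1))) (x * (r - 1)) 0 x
  refine ⟨a, b, c, e, hb, hc, he, h ▸ ?_⟩
  unfold suzukiComb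
  push_cast [Nat.cast_sub (Nat.one_le_iff_ne_zero.2 hr.ne')]
  ring

theorem Nat.eq_of_lt_of_int_dvd_sub {m x y : ℕ} (hx : x < m) (hy : y < m)
    (h : (m : ℤ) ∣ (x : ℤ) - y) : x = y :=
  (((Nat.modEq_iff_dvd).2 h).eq_of_lt_of_lt hy hx).symm

theorem suzukiComb_first_unique {r : ℕ} (hr : 0 < r) {a a' : ℤ} {b b' c c' e e' : ℕ}
    (hb : b < r) (hb' : b' < r) (hc : c < 2) (hc' : c' < 2) (he : e < r) (he' : e' < r)
    (h : suzukiComb r a b c e = suzukiComb r a' b' c' e') : a = a' := by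
  have hr0 : (r : ℤ) ≠ 0 := by exact_mod_cast hr.ne'
  unfold suzukiComb at h
  obtain rfl : e = e' := Nat.eq_of_lt_of_int_dvd_sub he he'
    ⟨(a' - a) * (2 * r) + (b' - b) * (2 * r + 2) + (c' - c) * (2 * r + 1)
      + (e' - e) * (2 * r + 2), by linear_combination h⟩
  have h₁ : a * (2 * r) + b * (2 * r + 2) + c * (2 * r + 1)
      = a' * (2 * r) + b' * (2 * r + 2) + c' * (2 * r + 1) :=
    mul_left_cancel₀ hr0 (by linear_combination h)
  obtain rfl : c = c' := Nat.eq_of_lt_of_int_dvd_sub hc hc'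
    ⟨(a' - a) * r + (b' - b) * (r + 1) + (c' - c) * r, by push_cast; linear_combination h₁⟩
  have h₂ : a * r + b * (r + 1) = a' * r + b' * (r + 1) :=
    mul_left_cancel₀ (two_ne_zero' ℤ) (by linear_combination h₁)
  obtain rfl : b = b' := Nat.eq_of_lt_of_int_dvd_sub hb hb'
    ⟨(a' - a) + (b' - b), by linear_combination h₂⟩
  exact mul_right_cancel₀ hr0 (by linear_combination h₂)

/-- The Suzuki semigroup with parameter `r = q₀`. -/
def suzukiSemigroup (r : ℕ) : AddSubmonoid ℕ :=
  AddSubmonoid.closure {2 * r ^ 2, 2 * r ^ 2 + r, 2 * r ^ 2 + 2 * r, 2 * r ^ 2 + 2 * r + 1}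

theorem mem_suzukiSemigroup_iff_exists {r x : ℕ} :
    x ∈ suzukiSemigroup r ↔ ∃ a b c e : ℕ, (x : ℤ) = suzukiComb r a b c e := by
  constructor
  · intro h
    induction h using AddSubmonoid.closure_induction with
    | mem x hx =>
      rcases hx with rfl | rfl | rfl | rfl
      · exact ⟨1, 0, 0, 0, by simp [suzukiComb]⟩
      · exact ⟨0, 0, 1, 0, by simp [suzukiComb]⟩
      · exact ⟨0, 1, 0, 0, by simp [suzukiComb]⟩
      · exact ⟨0, 0, 0, 1, by simp [suzukiComb]⟩
    | zero => exact ⟨0, 0, 0, 0, by simp [suzukiComb]⟩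
    | add x y _ _ hx hy =>
      obtain ⟨a, b, c, e, hx⟩ := hx
      obtain ⟨a', b', c', e', hy⟩ := hy
      refine ⟨a + a', b + b', c + c', e + e', ?_⟩
      push_cast
      rw [hx, hy]
      unfold suzukiComb
      ring
  · rintro ⟨a, b, c, e, h⟩
    have hx : x = a • (2 * r ^ 2) + b • (2 * r ^ 2 + 2 * r) + c • (2 * r ^ 2 + r)
        + e • (2 * r ^ 2 + 2 * r + 1) := by
      unfold suzukiComb at h
      simp only [smul_eq_mul]
      exact_mod_cast h
    rw [hx]
    refine add_mem (add_mem (add_mem ?_ ?_) ?_) ?_ <;>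
      exact nsmul_mem (AddSubmonoid.subset_closure (by simp)) _

theorem mem_suzukiSemigroup_iff_nonneg {r x : ℕ} (hr : 0 < r) {a : ℤ} {b c e : ℕ}
    (hb : b < r) (hc : c < 2) (he : e < r) (hx : (x : ℤ) = suzukiComb r a b c e) :
    x ∈ suzukiSemigroup r ↔ 0 ≤ a := by
  rw [mem_suzukiSemigroup_iff_exists]
  constructor
  · rintro ⟨a₁, b₁, c₁, e₁, h⟩
    obtain ⟨a', b', c', e', ha, hb', hc', he', h'⟩ := suzukiComb_normalize hr a₁ b₁ c₁ e₁
    have haa := suzukiComb_first_unique hr hb hb' hc hc' he he' (hx.symm.trans (h.trans h'))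
    omega
  · intro ha
    lift a to ℕ using ha
    exact ⟨a, b, c, e, hx⟩

/-- the numerical semigroup `H` is symmetric: for `0 ≤ s ≤ 2g-1`
one has `s ∈ H` iff `2g-1-s ∉ H`. -/
theorem suzuki_symmetric (n : ℕ) (hn : 2 ≤ n) (q₀ q : ℕ) (hq₀ : q₀ = 2 ^ n)
    (hq : q = 2 * q₀ ^ 2) (H : AddSubmonoid ℕ)
    (hH : H = AddSubmonoid.closure {q, q + q₀, q + 2 * q₀, q + 2 * q₀ + 1})
    (g : ℕ) (hg : g = q₀ * (q - 1)) :
    ∀ s : ℕ, s ≤ 2 * g - 1 → (s ∈ H ↔ (2 * g - 1 - s) ∉ H) := by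
  intro s hs
  have hr : 0 < q₀ := hq₀ ▸ by positivity
  have hq2 : 2 ≤ q := by nlinarith [pow_pos hr 2]
  have hg0 : 0 < g := hg ▸ Nat.mul_pos hr (by omega)
  obtain rfl : H = suzukiSemigroup q₀ := by rw [hH, hq, suzukiSemigroup]
  obtain ⟨a, b, c, e, hb, hc, he, hs'⟩ := exists_eq_suzukiComb hr s
  have hgz : (g : ℤ) = q₀ * (2 * q₀ ^ 2 - 1) := by
    rw [hg, Nat.cast_mul, Nat.cast_sub (by omega), hq]
    push_cast
    ring
  have ht : ((2 * g - 1 - s : ℕ) : ℤ) =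
      suzukiComb q₀ (-1 - a) (q₀ - 1 - b : ℕ) (1 - c : ℕ) (q₀ - 1 - e : ℕ) := by
    rw [Nat.cast_sub hs, Nat.cast_sub (by omega), hs', Nat.cast_sub (by omega : b ≤ q₀ - 1),
      Nat.cast_sub (by omega : c ≤ 1), Nat.cast_sub (by omega : e ≤ q₀ - 1),
      Nat.cast_sub (by omega : 1 ≤ q₀)]
    push_cast
    rw [hgz]
    unfold suzukiComb
    ring
  rw [mem_suzukiSemigroup_iff_nonneg hr hb hc he hs',
    mem_suzukiSemigroup_iff_nonneg hr (by omega) (by omega) (by omega) ht]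
  omega
end
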